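/- arXiv:2401.02918 — 8 statements merged into one kernel-verified Lean document; each statement's English description precedes it below -/
import Mathlib

section
/- Let b ∈ P(𝒜,𝒢) be an acyclic solution such that b_{ij} > 0 implies v_{ij} > 0. Then there exists an assignment σ : 𝒢 → 𝒜 such that NSW(σ) ≥ f_cvx(b) − D_KL(w‖u) − 2·log 2 − 1/(2e). -/
open Finset

/-- The feasibility polytope `P(𝒜,𝒢)`. -/
def Feasible {A G : Type*} [Fintype A] [Fintype G] (b : A → G → ℝ) : Prop :=
  (∀ i j, 0 ≤ b i j) ∧ (∀ i, ∑ j, b i j = 1) ∧ (∀ j, ∑ i, b i j ≤ 1)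

/-- The support graph of `b`: bipartite graph on `𝒜 ⊕ 𝒢` with an edge `{i,j}` iff `b i j > 0`. -/
def supportGraph {A G : Type*} (b : A → G → ℝ) : SimpleGraph (A ⊕ G) :=
  SimpleGraph.fromRel (fun x y => ∃ i j, x = Sum.inl i ∧ y = Sum.inr j ∧ 0 < b i j)

/-- Weighted Nash Social Welfare (log objective) of an assignment `σ : 𝒢 → 𝒜`. -/
noncomputable def NSW {A G : Type*} [Fintype A] [Fintype G] [DecidableEq A]
    (v : A → G → ℝ) (w : A → ℝ) (σ : G → A) : ℝ :=
  ∑ i, w i * Real.log (∑ j ∈ Finset.univ.filter (fun j => σ j = i), v i j)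

/-- The objective of the convex program CVX-Weighted. -/
noncomputable def fcvx {A G : Type*} [Fintype A] [Fintype G]
    (v : A → G → ℝ) (w : A → ℝ) (b : A → G → ℝ) : ℝ :=
  (∑ i, ∑ j, w i * b i j * Real.log (v i j))
    - ∑ j, (∑ i, w i * b i j) * Real.log (∑ i, w i * b i j)
    + ∑ i, w i * Real.log (w i)

/-- KL-divergence between the weights `w` and the uniform distribution on the agents. -/
noncomputable def DKL {A : Type*} [Fintype A] (w : A → ℝ) : ℝ :=
  Real.log (Fintype.card A) + ∑ i, w i * Real.log (w i)

/-- Tangent bound for the entropy function `p ↦ -p log p` at slope `log 2`. -/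
theorem neg_mul_log_le {p : ℝ} (hp : 0 ≤ p) :
    -(p * Real.log p) ≤ p * Real.log 2 + 1 / (2 * Real.exp 1) := by
  rcases hp.eq_or_lt with rfl | hp
  · simp; positivity
  have he : 0 < 2 * Real.exp 1 := by positivity
  have h := Real.log_le_sub_one_of_pos (x := 1 / (2 * Real.exp 1 * p)) (by positivity)
  rw [one_div, Real.log_inv, Real.log_mul he.ne' hp.ne',
    Real.log_mul two_ne_zero (Real.exp_pos 1).ne', Real.log_exp] at h
  have h2 := mul_le_mul_of_nonneg_left h hp.le
  have h3 : p * ((2 * Real.exp 1 * p)⁻¹ - 1) = 1 / (2 * Real.exp 1) - p := by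
    field_simp
  rw [h3] at h2
  linarith

/-- The log-sum inequality. -/
theorem sum_mul_log_div_le {G : Type*} (Y : Finset G) (b v : G → ℝ)
    (hb : ∀ j ∈ Y, 0 < b j) (hv : ∀ j ∈ Y, 0 < v j) :
    ∑ j ∈ Y, b j * (Real.log (v j) - Real.log (b j))
      + (∑ j ∈ Y, b j) * Real.log (∑ j ∈ Y, b j)
      ≤ (∑ j ∈ Y, b j) * Real.log (∑ j ∈ Y, v j) := by
  rcases Y.eq_empty_or_nonempty with rfl | hY
  · simp
  set p := ∑ j ∈ Y, b j with hp
  set V := ∑ j ∈ Y, v j with hV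
  have hp0 : 0 < p := sum_pos hb hY
  have hV0 : 0 < V := sum_pos hv hY
  have key : ∀ j ∈ Y, b j * (Real.log (v j) - Real.log (b j)) + b j * (Real.log p - Real.log V)
      ≤ v j * (p / V) - b j := by
    intro j hj
    have hbj := hb j hj
    have hvj := hv j hj
    have h := Real.log_le_sub_one_of_pos (x := v j * p / (b j * V)) (by positivity)
    rw [Real.log_div (by positivity) (by positivity), Real.log_mul hvj.ne' hp0.ne',
      Real.log_mul hbj.ne' hV0.ne'] at h
    have h2 := mul_le_mul_of_nonneg_left h hbj.le
    have h3 : b j * (v j * p / (b j * V) - 1) = v j * (p / V) - b j := by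
      field_simp
    rw [h3] at h2
    linarith
  have hs := sum_le_sum key
  rw [sum_add_distrib, ← sum_mul, sum_sub_distrib, ← sum_mul, ← hp, ← hV,
    mul_div_cancel₀ _ hV0.ne'] at hs
  linarith

/-- Lower bound on what an agent gains by receiving the whole bundle `Y` with probability
`∑ j ∈ Y, b j`; `M j` is the value lost elsewhere when item `j` is used. -/
theorem bundle_bound {G : Type*} (Y : Finset G) (b c q M v : G → ℝ) (w m F : ℝ) (hw : 0 ≤ w)
    (hb : ∀ j ∈ Y, 0 < b j) (hv : ∀ j ∈ Y, 0 < v j) (hq : ∀ j ∈ Y, b j ≤ q j)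
    (hM : ∀ j ∈ Y, 0 ≤ M j) (hc : ∀ j ∈ Y, ∑ k ∈ Y, b k ≤ 1 - c j)
    (hF : Y.Nonempty → w * Real.log (∑ j ∈ Y, v j) + m - ∑ j ∈ Y, M j ≤ F) :
    (∑ j ∈ Y, b j) * m - ∑ j ∈ Y, (1 - c j) * M j
      + w * ∑ j ∈ Y, b j * (Real.log (v j) - Real.log (q j))
      - w * ((∑ j ∈ Y, b j) * Real.log 2 + 1 / (2 * Real.exp 1)) ≤ (∑ j ∈ Y, b j) * F := by
  rcases Y.eq_empty_or_nonempty with rfl | hY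
  · simp; positivity
  have h1 := mul_le_mul_of_nonneg_left (hF hY) (sum_nonneg fun j hj => (hb j hj).le)
  have h2 : (∑ j ∈ Y, b j) * ∑ j ∈ Y, M j ≤ ∑ j ∈ Y, (1 - c j) * M j := by
    rw [mul_sum]
    exact sum_le_sum fun j hj => mul_le_mul_of_nonneg_right (hc j hj) (hM j hj)
  have h3 := sum_mul_log_div_le Y b v hb hv
  have h4 : ∑ j ∈ Y, b j * (Real.log (v j) - Real.log (q j))
      ≤ ∑ j ∈ Y, b j * (Real.log (v j) - Real.log (b j)) :=
    sum_le_sum fun j hj => mul_le_mul_of_nonneg_left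
      (sub_le_sub_left (Real.log_le_log (hb j hj) (hq j hj)) _) (hb j hj).le
  have h5 := neg_mul_log_le (sum_nonneg fun j hj => (hb j hj).le : 0 ≤ ∑ j ∈ Y, b j)
  have h6 : w * (∑ j ∈ Y, b j * (Real.log (v j) - Real.log (q j))
      - ((∑ j ∈ Y, b j) * Real.log 2 + 1 / (2 * Real.exp 1)))
      ≤ w * ((∑ j ∈ Y, b j) * Real.log (∑ j ∈ Y, v j)) :=
    mul_le_mul_of_nonneg_left (by linarith) hw
  linarith

/-- A set of total mass at most `1` splits into a part of mass at most `1 / 2` and a part whose mass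
exceeds `1 / 2` by at most its smallest element. -/
theorem exists_balanced_subset {G : Type*} [DecidableEq G] (S : Finset G) (b : G → ℝ)
    (hS : ∑ j ∈ S, b j ≤ 1) (hb : ∀ j ∈ S, 0 ≤ b j) :
    ∃ U ⊆ S, (∀ j ∈ U, ∑ k ∈ U, b k ≤ 1 / 2 + b j) ∧ ∑ k ∈ S \ U, b k ≤ 1 / 2 := by
  by_cases h : ∑ j ∈ S, b j ≤ 1 / 2
  · exact ⟨S, Subset.rfl, fun j hj => by linarith [hb j hj], by simp⟩
  obtain ⟨U, ⟨hUS, hU⟩, hmin⟩ := exists_minimal_of_wellFoundedLT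
    (fun U : Finset G => U ⊆ S ∧ 1 / 2 < ∑ k ∈ U, b k) ⟨S, Subset.rfl, not_le.mp h⟩
  refine ⟨U, hUS, fun j hj => ?_, ?_⟩
  · by_contra! hlt
    have := add_sum_erase U b hj
    have h2 := hmin (y := U.erase j) ⟨(erase_subset _ _).trans hUS, by linarith⟩ (erase_subset _ _)
    exact notMem_erase j U (h2 hj)
  · have := sum_sdiff (f := b) hUS
    linarith

/-- Rounding at one agent: with probability `x` it receives a distinguished item of value `v₀`, and
otherwise a best bundle from its private items `P`, where an unused item `j` is worth `M j`. -/
theorem agent_bound {G : Type*} [DecidableEq G] (P : Finset G) (b c q M v : G → ℝ)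
    (w F x v₀ q₀ : ℝ) (hw : 0 ≤ w)
    (hb : ∀ j ∈ P, 0 < b j) (hv : ∀ j ∈ P, 0 < v j) (hM : ∀ j ∈ P, 0 ≤ M j)
    (hq : ∀ j ∈ P, b j + c j ≤ q j) (hc : ∀ j ∈ P, 0 ≤ c j) (hq1 : ∀ j ∈ P, q j ≤ 1)
    (hx : 0 ≤ x) (hxq : x ≤ q₀) (hsum : x + ∑ j ∈ P, b j = 1)
    (hF : ∀ Y ⊆ P, Y.Nonempty → w * Real.log (∑ j ∈ Y, v j) + ∑ j ∈ P \ Y, M j ≤ F) :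
    w * (x * (Real.log v₀ - Real.log q₀) + ∑ j ∈ P, b j * (Real.log (v j) - Real.log (q j)))
      - w * (Real.log 2 + 3 / (2 * Real.exp 1)) + ∑ j ∈ P, c j * M j
      ≤ (1 - x) * F + x * (w * Real.log v₀ + ∑ j ∈ P, M j) := by
  set m := ∑ j ∈ P, M j with hm
  have hF' : ∀ Y ⊆ P, Y.Nonempty → w * Real.log (∑ j ∈ Y, v j) + m - ∑ j ∈ Y, M j ≤ F := by
    intro Y hY hne
    have h1 := hF Y hY hne
    have h2 := sum_sdiff (f := M) hY
    linarith
  set S := P.filter (fun j => q j < 1 / 2) with hSdef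
  have hSP : S ⊆ P := filter_subset _ _
  have hTP : P \ S ⊆ P := sdiff_subset
  have hPsum := fun f : G → ℝ => sum_sdiff (f := f) hSP
  have hb0 : ∀ j ∈ P, 0 ≤ b j := fun j hj => (hb j hj).le
  have hS1 : ∑ j ∈ S, b j ≤ 1 := by
    have := hPsum b
    have := sum_nonneg fun j (hj : j ∈ P \ S) => hb0 j (hTP hj)
    linarith
  obtain ⟨U, hUS, hU1, hU2⟩ := exists_balanced_subset S b hS1 fun j hj => hb0 j (hSP hj)
  have hSsum := fun f : G → ℝ => sum_sdiff (f := f) hUS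
  have bound : ∀ Y ⊆ S, (∀ j ∈ Y, ∑ k ∈ Y, b k ≤ 1 - c j) → _ := fun Y hY hc' =>
    bundle_bound Y b c q M v w m F hw (fun j hj => hb j (hSP (hY hj)))
      (fun j hj => hv j (hSP (hY hj)))
      (fun j hj => by linarith [hq j (hSP (hY hj)), hc j (hSP (hY hj))])
      (fun j hj => hM j (hSP (hY hj))) hc' (hF' Y (hY.trans hSP))
  have hsmall : ∀ j ∈ S, b j + c j < 1 / 2 := fun j hj =>
    (hq j (hSP hj)).trans_lt (mem_filter.mp hj).2
  have B1 := bound U hUS fun j hj => by linarith [hU1 j hj, hsmall j (hUS hj)]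
  have B2 := bound (S \ U) sdiff_subset fun j hj => by
    linarith [hsmall j (sdiff_subset hj), hb0 j (hSP (sdiff_subset hj))]
  have B3 : ∑ j ∈ P \ S, (b j * m - (1 - c j) * M j
      + w * (b j * (Real.log (v j) - Real.log (q j))) - w * (b j * Real.log 2))
      ≤ ∑ j ∈ P \ S, b j * F := by
    refine sum_le_sum fun j hj => ?_
    have hjP := hTP hj
    have hqj : 1 / 2 ≤ q j := by
      by_contra! hlt
      exact (mem_sdiff.mp hj).2 (mem_filter.mpr ⟨hjP, hlt⟩)
    have h1 := hF' {j} (singleton_subset_iff.mpr hjP) (singleton_nonempty j)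
    simp only [sum_singleton] at h1
    have h2 := mul_le_mul_of_nonneg_left h1 (hb0 j hjP)
    have h3 : -Real.log 2 ≤ Real.log (q j) := by
      rw [← Real.log_inv]
      exact Real.log_le_log (by norm_num) (by linarith)
    have h4 : b j * M j ≤ (1 - c j) * M j :=
      mul_le_mul_of_nonneg_right (by linarith [hq j hjP, hq1 j hjP]) (hM j hjP)
    have h5 := mul_le_mul_of_nonneg_left h3 (mul_nonneg hw (hb0 j hjP))
    linarith
  have B4 : -(x * Real.log q₀) ≤ x * Real.log 2 + 1 / (2 * Real.exp 1) := by
    refine le_trans ?_ (neg_mul_log_le hx)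
    rcases hx.eq_or_lt with rfl | hx
    · simp
    · exact neg_le_neg (mul_le_mul_of_nonneg_left (Real.log_le_log hx hxq) hx.le)
  have B4' := mul_le_mul_of_nonneg_left B4 hw
  simp only [sum_sub_distrib, sum_add_distrib, ← sum_mul, ← mul_sum] at B3
  have e1 := hPsum b
  have e2 := hSsum b
  have e3 := hPsum fun j => (1 - c j) * M j
  have e4 := hSsum fun j => (1 - c j) * M j
  have e5 := hPsum fun j => b j * (Real.log (v j) - Real.log (q j))
  have e6 := hSsum fun j => b j * (Real.log (v j) - Real.log (q j))
  have e7 : ∑ j ∈ P, (1 - c j) * M j = m - ∑ j ∈ P, c j * M j := by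
    rw [hm, ← sum_sub_distrib]
    exact sum_congr rfl fun j _ => by ring
  have e8 : 3 / (2 * Real.exp 1) = 3 * (1 / (2 * Real.exp 1)) := by ring
  have t : ∑ j ∈ P, b j = 1 - x := by linarith
  rw [e8]
  rw [← e5, ← e6]
  generalize 1 / (2 * Real.exp 1) = e at *
  simp only [← e2] at e1
  have hx' : x = 1 - (∑ j ∈ P \ S, b j + (∑ j ∈ S \ U, b j + ∑ j ∈ U, b j)) := by linarith
  have hcM : ∑ j ∈ P, c j * M j = m - (∑ j ∈ P \ S, (1 - c j) * M j
    + (∑ j ∈ S \ U, (1 - c j) * M j + ∑ j ∈ U, (1 - c j) * M j)) := by linarith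
  rw [hcM]
  simp only [hx'] at B4' ⊢
  linarith

/-- A finite nonempty forest has a vertex with at most one neighbour. -/
theorem exists_forall_adj_eq {V : Type*} [Finite V] [Nonempty V] {H : SimpleGraph V}
    (hH : H.IsAcyclic) : ∃ u z, ∀ x, H.Adj u x → x = z := by
  obtain ⟨u, t, p, hp, hmax⟩ := SimpleGraph.Walk.exists_isPath_forall_isPath_length_le_length H
  refine ⟨u, p.snd, fun x hx => hH.eq_snd_of_adj_start hp hx ?_⟩
  by_contra hns
  have := hmax _ _ (p.cons hx.symm) (hp.cons hns)
  simp at this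

/-- In an acyclic solution, among any nonempty set of agents some agent shares at most one item with
the others. -/
theorem exists_agent_with_one_shared_item {A G : Type*} [Finite A] [Finite G] [Nonempty G]
    (b : A → G → ℝ) (hacyc : (supportGraph b).IsAcyclic) (s : Finset A) (hs : s.Nonempty) :
    ∃ i ∈ s, ∃ j₀, ∀ j, j ≠ j₀ → 0 < b i j → ∀ i' ∈ s, i' ≠ i → ¬ 0 < b i' j := by
  classical
  have hadj : ∀ i j, 0 < b i j → (supportGraph b).Adj (Sum.inl i) (Sum.inr j) := by
    intro i j h
    simp [supportGraph, h]
  set W : Set (A ⊕ G) := {x | (∃ i ∈ s, x = Sum.inl i) ∨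
    ∃ j, x = Sum.inr j ∧ ∃ i ∈ s, ∃ i' ∈ s, i' ≠ i ∧ 0 < b i j ∧ 0 < b i' j} with hW
  obtain ⟨i₀, hi₀⟩ := hs
  have : Nonempty W := ⟨⟨Sum.inl i₀, Or.inl ⟨i₀, hi₀, rfl⟩⟩⟩
  obtain ⟨⟨u, hu⟩, ⟨z, hz⟩, huz⟩ := exists_forall_adj_eq (hacyc.induce W)
  have huz' : ∀ x ∈ W, (supportGraph b).Adj u x → x = z := fun x hx h =>
    congrArg Subtype.val (huz ⟨x, hx⟩ h)
  rcases hu with ⟨i, his, rfl⟩ | ⟨j, rfl, i, his, i', his', hne, h1, h2⟩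
  · have hshared : ∀ j, 0 < b i j → ∀ i' ∈ s, i' ≠ i → 0 < b i' j → Sum.inr j = z :=
      fun j hj i' his' hne hj' =>
        huz' _ (Or.inr ⟨j, rfl, i, his, i', his', hne, hj, hj'⟩) (hadj i j hj)
    cases z with
    | inl k =>
      exact ⟨i, his, Classical.arbitrary G, fun j _ hj i' his' hne hj' =>
        by simpa using hshared j hj i' his' hne hj'⟩
    | inr j₀ =>
      exact ⟨i, his, j₀, fun j hjj hj i' his' hne hj' =>
        hjj (by simpa using hshared j hj i' his' hne hj')⟩
  · have e1 := huz' (Sum.inl i) (Or.inl ⟨i, his, rfl⟩) (hadj i j h1).symm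
    have e2 := huz' (Sum.inl i') (Or.inl ⟨i', his', rfl⟩) (hadj i' j h2).symm
    exact absurd (Sum.inl_injective (e2.trans e1.symm)) hne

/-- The convex objective exceeds the non-convex one, in which item prices are the total fractional
assignments, by at most the KL-divergence of the weights from uniform. -/
theorem fcvx_sub_DKL_le {A G : Type*} [Fintype A] [Fintype G]
    (v : A → G → ℝ) (w : A → ℝ) (hw : ∀ i, 0 < w i) (hws : ∑ i, w i = 1)
    (b : A → G → ℝ) (hb : Feasible b) :
    fcvx v w b - DKL w
      ≤ ∑ i, w i * ∑ j, b i j * (Real.log (v i j) - Real.log (∑ k, b k j)) := by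
  obtain ⟨hb0, hb1, -⟩ := hb
  have hn : 0 < (Fintype.card A : ℝ) := by
    have : Nonempty A := by
      by_contra h
      rw [not_nonempty_iff] at h
      simp at hws
    exact_mod_cast Fintype.card_pos
  set n : ℝ := (Fintype.card A : ℝ)
  set q : G → ℝ := fun j => ∑ k, b k j with hq
  set p : G → ℝ := fun j => ∑ i, w i * b i j with hp
  have hp0 : ∀ j, 0 ≤ p j := fun j => sum_nonneg fun i _ => mul_nonneg (hw i).le (hb0 i j)
  have hq0 : ∀ j, 0 ≤ q j := fun j => sum_nonneg fun i _ => hb0 i j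
  have hps : ∑ j, p j = 1 := by
    rw [hp, sum_comm]
    simp [← mul_sum, hb1, hws]
  have hqs : ∑ j, q j = n := by
    rw [hq, sum_comm]
    simp [hb1, n]
  have key : ∀ j, p j * (Real.log (q j) - Real.log (p j) - Real.log n) ≤ q j / n - p j := by
    intro j
    rcases (hp0 j).eq_or_lt with h | h
    · rw [← h]
      have := hq0 j
      simp only [zero_mul, sub_zero]
      positivity
    · have hqj : 0 < q j := by
        refine (hq0 j).lt_of_ne fun h0 => ?_
        have hz : ∀ i ∈ univ, b i j = 0 := (sum_eq_zero_iff_of_nonneg fun i _ => hb0 i j).mp h0.symm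
        have : p j = 0 := sum_eq_zero fun i hi => by rw [hz i hi, mul_zero]
        exact h.ne' this
      have h1 := Real.log_le_sub_one_of_pos (x := q j / (p j * n)) (by positivity)
      rw [Real.log_div hqj.ne' (by positivity), Real.log_mul h.ne' hn.ne'] at h1
      have h2 := mul_le_mul_of_nonneg_left h1 h.le
      have h3 : p j * (q j / (p j * n) - 1) = q j / n - p j := by field_simp
      rw [h3] at h2
      linarith
  have hs := sum_le_sum fun j (_ : j ∈ univ) => key j
  simp only [mul_sub, sum_sub_distrib, ← sum_mul, ← sum_div] at hs
  rw [hps, hqs, div_self hn.ne'] at hs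
  have e1 : ∑ i, w i * ∑ j, b i j * (Real.log (v i j) - Real.log (q j))
      = ∑ i, ∑ j, w i * b i j * Real.log (v i j) - ∑ j, p j * Real.log (q j) := by
    simp only [hp, sum_mul]
    rw [sum_comm (f := fun j i => w i * b i j * Real.log (q j)), ← sum_sub_distrib]
    refine sum_congr rfl fun i _ => ?_
    rw [mul_sum, ← sum_sub_distrib]
    exact sum_congr rfl fun j _ => by ring
  rw [e1]
  simp only [fcvx, DKL]
  change _ - ∑ j, p j * Real.log (p j) + _ - (Real.log n + _) ≤ _
  linarith

/-- Rounding for a subset `s` of the agents, where leaving item `j` unassigned is worth `M j` and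
happens fractionally with mass `c j`. -/
theorem exists_partial_assignment {A G : Type*} [Finite A] [Fintype G] [Nonempty G]
    [DecidableEq A] [DecidableEq G] (v b : A → G → ℝ) (w : A → ℝ) (q : G → ℝ)
    (hw : ∀ i, 0 < w i) (hb0 : ∀ i j, 0 ≤ b i j) (hb1 : ∀ i, ∑ j, b i j = 1)
    (hq1 : ∀ j, q j ≤ 1) (hacyc : (supportGraph b).IsAcyclic)
    (hsupp : ∀ i j, 0 < b i j → 0 < v i j) (s : Finset A) (c M : G → ℝ)
    (hc : ∀ j, 0 ≤ c j) (hM : ∀ j, 0 ≤ M j) (hq : ∀ j, ∑ i ∈ s, b i j + c j ≤ q j) :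
    ∃ τ : G → Option A, (∀ j i, τ j = some i → i ∈ s ∧ 0 < b i j) ∧
      (∀ i ∈ s, ∃ j, τ j = some i) ∧
      ∑ i ∈ s, (w i * ∑ j, b i j * (Real.log (v i j) - Real.log (q j))
          - w i * (Real.log 2 + 3 / (2 * Real.exp 1))) + ∑ j, c j * M j
        ≤ ∑ i ∈ s, w i * Real.log (∑ j with τ j = some i, v i j) + ∑ j with τ j = none, M j := by
  induction s using Finset.strongInduction generalizing c M with
  | H s ih =>
  rcases s.eq_empty_or_nonempty with rfl | hs
  · refine ⟨fun _ => none, by simp, by simp, ?_⟩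
    simp only [sum_empty, zero_add, filter_true]
    exact sum_le_sum fun j _ => mul_le_of_le_one_left (hM j) (by
      have := hq j
      simp only [sum_empty, zero_add] at this
      exact this.trans (hq1 j))
  obtain ⟨i, his, j₀, hpriv⟩ := exists_agent_with_one_shared_item b hacyc s hs
  have hs' : ∀ f : A → ℝ, f i + ∑ k ∈ s.erase i, f k = ∑ k ∈ s, f k :=
    fun f => add_sum_erase s f his
  have hsb : ∀ j, 0 ≤ ∑ k ∈ s.erase i, b k j := fun j => sum_nonneg fun k _ => hb0 k j
  set x := b i j₀ with hx
  set P : Finset G := univ.filter (fun j => j ≠ j₀ ∧ 0 < b i j) with hP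
  have memP : ∀ j, j ∈ P ↔ j ≠ j₀ ∧ 0 < b i j := fun j => by simp [hP]
  have hj₀P : j₀ ∉ P := by simp [hP]
  have hsplit : ∀ f : G → ℝ, ∑ j, b i j * f j = x * f j₀ + ∑ j ∈ P, b i j * f j := by
    intro f
    rw [← add_sum_erase univ _ (mem_univ j₀)]
    congr 1
    refine (sum_subset (fun j hj => ?_) fun j hj hjP => ?_).symm
    · simpa using ((memP j).mp hj).1
    · have hz : b i j = 0 := by
        refine le_antisymm (not_lt.mp fun h => hjP ((memP j).mpr ⟨ne_of_mem_erase hj, h⟩)) (hb0 i j)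
      rw [hz, zero_mul]
  have hsum : x + ∑ j ∈ P, b i j = 1 := by
    have := hsplit fun _ => 1
    simp only [mul_one, hb1] at this
    exact this.symm
  set t := w i * Real.log (v i j₀) + ∑ j ∈ P, M j with ht
  obtain ⟨F, hF, hF'⟩ : ∃ F, (∀ Y ⊆ P, Y.Nonempty →
      w i * Real.log (∑ j ∈ Y, v i j) + ∑ j ∈ P \ Y, M j ≤ F) ∧
      ((∃ Y ⊆ P, Y.Nonempty ∧ F = w i * Real.log (∑ j ∈ Y, v i j) + ∑ j ∈ P \ Y, M j) ∨
        (P = ∅ ∧ M j₀ < t - F)) := by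
    rcases P.eq_empty_or_nonempty with hPe | hPn
    · refine ⟨t - M j₀ - 1, fun Y hY hne => ?_, Or.inr ⟨hPe, by linarith⟩⟩
      rw [hPe, subset_empty] at hY
      exact absurd hY hne.ne_empty
    · obtain ⟨Y, hY, hmax⟩ := exists_max_image (P.powerset.filter Finset.Nonempty)
        (fun Y => w i * Real.log (∑ j ∈ Y, v i j) + ∑ j ∈ P \ Y, M j)
        ⟨P, by simpa using hPn⟩
      simp only [mem_filter, mem_powerset] at hY hmax
      exact ⟨_, fun Z hZ hne => hmax Z ⟨hZ, hne⟩, Or.inl ⟨Y, hY.1, hY.2, rfl⟩⟩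
  have hagent := agent_bound P (b i) c q M (v i) (w i) F x (v i j₀) (q j₀) (hw i).le
    (fun j hj => ((memP j).mp hj).2) (fun j hj => hsupp i j ((memP j).mp hj).2)
    (fun j _ => hM j) (fun j _ => by linarith [hq j, hs' (b · j), hsb j])
    (fun j _ => hc j) (fun j _ => hq1 j) (hb0 i j₀)
    (by linarith [hq j₀, hs' (b · j₀), hsb j₀, hc j₀]) hsum hF
  set N := if 0 < x ∧ M j₀ < t - F then t - F else M j₀ with hN
  have hMN : M j₀ ≤ N := by
    rw [hN]; split_ifs with h
    exacts [h.2.le, le_rfl]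
  have hxN : x * (t - F) ≤ x * N := by
    rcases (hb0 i j₀).eq_or_lt with h | h
    · rw [hx, ← h, zero_mul, zero_mul]
    · refine mul_le_mul_of_nonneg_left ?_ h.le
      rw [hN]; split_ifs with h'
      · exact le_rfl
      · exact not_lt.mp fun h'' => h' ⟨h, h''⟩
  set M' : G → ℝ := fun j => if j ∈ P then 0 else if j = j₀ then N else M j with hM'
  set c' : G → ℝ := fun j => if j = j₀ then c j₀ + x else c j with hc'
  obtain ⟨τ, hτ, hτs, hval⟩ := ih (s.erase i) (erase_ssubset his) c' M'
    (fun j => by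
      rw [hc']; dsimp only; split_ifs
      exacts [add_nonneg (hc _) (hb0 _ _), hc j])
    (fun j => by
      rw [hM']; dsimp only; split_ifs
      exacts [le_rfl, (hM _).trans hMN, hM j])
    (fun j => by
      have h1 := hs' (b · j)
      have h2 := hq j
      rw [hc']; dsimp only; split_ifs with h
      · subst h; linarith
      · linarith [hb0 i j])
  have hτi : ∀ j, τ j ≠ some i := fun j h => notMem_erase i s (hτ j i h).1
  have hτP : ∀ j ∈ P, τ j = none := by
    intro j hj
    rw [Option.eq_none_iff_forall_ne_some]
    intro k hk
    obtain ⟨hks, hkb⟩ := hτ j k hk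
    exact hpriv j ((memP j).mp hj).1 ((memP j).mp hj).2 k (mem_of_mem_erase hks)
      (ne_of_mem_erase hks) hkb
  have hcM : ∑ j, c j * M j + x * (t - F) ≤ ∑ j, c' j * M' j + ∑ j ∈ P, c j * M j := by
    have e1 : x * (t - F) = ∑ j, if j = j₀ then x * (t - F) else 0 := by simp
    have e2 : ∑ j ∈ P, c j * M j = ∑ j, if j ∈ P then c j * M j else 0 := by simp
    rw [e1, e2, ← sum_add_distrib, ← sum_add_distrib]
    refine sum_le_sum fun j _ => ?_
    by_cases hj : j = j₀
    · subst hj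
      have := mul_le_mul_of_nonneg_left hMN (hc j)
      simp only [hc', hM', hj₀P, if_true, if_false]
      linarith
    · by_cases hjP : j ∈ P <;> simp [hc', hM', hj, hjP]
  -- It suffices to extend `τ` to agent `i` at a gain of `F`.
  suffices h : ∃ τ' : G → Option A, (∀ j k, τ' j = some k → k ∈ s ∧ 0 < b k j) ∧
      (∀ k ∈ s.erase i, ∀ j, τ' j = some k ↔ τ j = some k) ∧ (∃ j, τ' j = some i) ∧
      F + ∑ j with τ j = none, M' j
        ≤ w i * Real.log (∑ j with τ' j = some i, v i j) + ∑ j with τ' j = none, M j by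
    obtain ⟨τ', h1, h2, h3, h4⟩ := h
    refine ⟨τ', h1, fun k hk => ?_, ?_⟩
    · by_cases hki : k = i
      · exact hki ▸ h3
      · obtain ⟨j, hj⟩ := hτs k (mem_erase.mpr ⟨hki, hk⟩)
        exact ⟨j, (h2 k (mem_erase.mpr ⟨hki, hk⟩) j).mpr hj⟩
    · rw [← hs', ← hs' (fun k => w k * Real.log _), hsplit]
      have e : ∑ k ∈ s.erase i, w k * Real.log (∑ j with τ' j = some k, v k j)
          = ∑ k ∈ s.erase i, w k * Real.log (∑ j with τ j = some k, v k j) :=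
        sum_congr rfl fun k hk => by simp only [h2 k hk]
      rw [e]
      linarith
  by_cases hA : (0 < x ∧ M j₀ < t - F) ∧ τ j₀ = none
  · obtain ⟨hA, hj₀⟩ := hA
    refine ⟨Function.update τ j₀ (some i), fun j k hjk => ?_, fun k hk j => ?_, ⟨j₀, by simp⟩, ?_⟩
    · by_cases hj : j = j₀
      · subst hj
        obtain rfl : i = k := by simpa using hjk
        exact ⟨his, hA.1⟩
      · rw [Function.update_of_ne hj] at hjk
        exact ⟨mem_of_mem_erase (hτ j k hjk).1, (hτ j k hjk).2⟩
    · by_cases hj : j = j₀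
      · subst hj
        simp [hj₀, (ne_of_mem_erase hk).symm]
      · rw [Function.update_of_ne hj]
    · have e1 : univ.filter (fun j => Function.update τ j₀ (some i) j = some i) = {j₀} := by
        ext j
        by_cases hj : j = j₀
        · subst hj; simp
        · simp [hj, hτi]
      rw [e1, sum_singleton, sum_filter, sum_filter]
      have e2 : ∑ j, (if τ j = none then M' j else 0) + ∑ j ∈ P, M j
          = ∑ j, (if Function.update τ j₀ (some i) j = none then M j else 0) + (t - F) := by
        have e3 : ∑ j ∈ P, M j = ∑ j, if j ∈ P then M j else 0 := by simp
        have e4 : t - F = ∑ j, if j = j₀ then t - F else 0 := by simp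
        rw [e3, e4, ← sum_add_distrib, ← sum_add_distrib]
        refine sum_congr rfl fun j _ => ?_
        by_cases hj : j = j₀
        · subst hj
          simp [hM', hN, hA, hj₀, hj₀P]
        · by_cases hjP : j ∈ P <;> simp [hM', hj, hjP, hτP]
      linarith
  · have hN' : τ j₀ = none → N = M j₀ := fun h => if_neg fun h' => hA ⟨h', h⟩
    obtain ⟨Y, hYP, ⟨y, hy⟩, hFY⟩ | ⟨hPe, hlt⟩ := hF'
    · refine ⟨fun j => if j ∈ Y then some i else τ j, fun j k hjk => ?_, fun k hk j => ?_,
        ⟨y, by simp [hy]⟩, ?_⟩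
      · by_cases hj : j ∈ Y
        · obtain rfl : i = k := by simpa [hj] using hjk
          exact ⟨his, ((memP j).mp (hYP hj)).2⟩
        · simp only [hj, if_false] at hjk
          exact ⟨mem_of_mem_erase (hτ j k hjk).1, (hτ j k hjk).2⟩
      · by_cases hj : j ∈ Y
        · simp [hj, hτP j (hYP hj), (ne_of_mem_erase hk).symm]
        · simp [hj]
      · have e1 : univ.filter (fun j => (if j ∈ Y then some i else τ j) = some i) = Y := by
          ext j
          by_cases hj : j ∈ Y <;> simp [hj, hτi]
        rw [e1, sum_filter, sum_filter, hFY]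
        have e2 : ∑ j ∈ P \ Y, M j + ∑ j, (if τ j = none then M' j else 0)
            = ∑ j, (if (if j ∈ Y then some i else τ j) = none then M j else 0) := by
          have e3 : ∑ j ∈ P \ Y, M j = ∑ j, if j ∈ P \ Y then M j else 0 := by
            rw [sum_ite_mem, univ_inter]
          rw [e3, ← sum_add_distrib]
          refine sum_congr rfl fun j _ => ?_
          by_cases hj : j = j₀
          · subst hj
            have : j ∉ Y := fun h => hj₀P (hYP h)
            by_cases hn : τ j = none <;> simp [hM', hn, hN', hj₀P, this]
          · by_cases hjP : j ∈ P
            · by_cases hjY : j ∈ Y <;> simp [hM', hjP, hjY, hτP]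
            · have : j ∉ Y := fun h => hjP (hYP h)
              simp [hM', hj, hjP, this]
        linarith
    · have hx1 : x = 1 := by simpa [hPe] using hsum
      refine absurd ⟨⟨by rw [hx1]; exact one_pos, hlt⟩, ?_⟩ hA
      rw [Option.eq_none_iff_forall_ne_some]
      intro k hk
      obtain ⟨hks, hkb⟩ := hτ j₀ k hk
      have h1 := single_le_sum (f := (b · j₀)) (fun k _ => hb0 k j₀) hks
      have h2 := hs' (b · j₀)
      linarith [hq j₀, hq1 j₀, hc j₀]

/-- Let `b ∈ P(𝒜,𝒢)` be an acyclic solution such that `b i j > 0` implies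
`v i j > 0`.  Then there exists an assignment `σ : 𝒢 → 𝒜` such that
`NSW(σ) ≥ f_cvx(b) − D_KL(w‖u) − 2·log 2 − 1/(2e)`. -/
theorem round_acyclic_solution
    (A G : Type*) [Fintype A] [Fintype G] [DecidableEq A]
    (v : A → G → ℝ) (w : A → ℝ)
    (hv : ∀ i j, 0 ≤ v i j) (hw : ∀ i, 0 < w i) (hws : ∑ i, w i = 1)
    (b : A → G → ℝ) (hb : Feasible b)
    (hacyc : (supportGraph b).IsAcyclic)
    (hsupp : ∀ i j, 0 < b i j → 0 < v i j) :
    ∃ σ : G → A,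
      NSW v w σ ≥ fcvx v w b - DKL w - 2 * Real.log 2 - 1 / (2 * Real.exp 1) := by
  classical
  have hcvx := fcvx_sub_DKL_le v w hw hws b hb
  obtain ⟨hb0, hb1, hb2⟩ := hb
  obtain ⟨k⟩ : Nonempty A := by
    by_contra h
    rw [not_nonempty_iff] at h
    simp at hws
  have : Nonempty G := by
    by_contra h
    rw [not_nonempty_iff] at h
    simpa using hb1 k
  obtain ⟨τ, hτ, hτs, hval⟩ := exists_partial_assignment v b w (fun j => ∑ i, b i j) hw hb0 hb1
    hb2 hacyc hsupp univ 0 0 (fun _ => le_rfl) (fun _ => le_rfl) (fun j => by simp)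
  refine ⟨fun j => (τ j).getD k, ?_⟩
  have hle : ∑ i, w i * Real.log (∑ j with τ j = some i, v i j)
      ≤ NSW v w fun j => (τ j).getD k := by
    refine sum_le_sum fun i _ => mul_le_mul_of_nonneg_left (Real.log_le_log ?_ ?_) (hw i).le
    · obtain ⟨j, hj⟩ := hτs i (mem_univ i)
      exact sum_pos' (fun j _ => hv i j) ⟨j, by simpa using hj, hsupp i j (hτ j i hj).2⟩
    · refine sum_le_sum_of_subset_of_nonneg (fun j hj => ?_) fun j _ _ => hv i j
      simp only [mem_filter, mem_univ, true_and] at hj ⊢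
      rw [hj, Option.getD_some]
  simp only [Pi.zero_apply, mul_zero, sum_const_zero, add_zero, sum_sub_distrib, ← sum_mul, hws,
    one_mul] at hval
  have he : 1 / Real.exp 1 ≤ Real.log 2 := by
    have h1 := Real.log_two_gt_d9
    have h2 := Real.exp_one_gt_d9
    rw [div_le_iff₀ (Real.exp_pos 1)]
    nlinarith
  have e1 : 3 / (2 * Real.exp 1) = 1 / Real.exp 1 + 1 / (2 * Real.exp 1) := by
    field_simp
    norm_num
  rw [e1] at hval
  linarith
end

section
/- Under the matching assumption, sup_{x∈X} inf_{y∈Q} Σ_{i∈𝒜} w_i log(Σ_{j∈𝒢} x_{ij} v_{ij} y_j^{1/w_i}) = sup_{b∈P(𝒜,𝒢)} f_cvx(b); that is, the optimal values of the weighted log-concave program and of the convex program CVX-Weighted are the same. -/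
open Finset

/-- Natural logarithm valued in the extended reals, with `log 0 = ⊥` (i.e. `−∞`). -/
noncomputable def elog (x : ℝ) : EReal := if x ≤ 0 then (⊥ : EReal) else ((Real.log x : ℝ) : EReal)

/-- The objective `f_cvx` of the convex program CVX-Weighted, valued in the extended reals,
with the conventions `0·log 0 = 0`, `b_{ij} log v_{ij} = 0` whenever `b_{ij} = 0`, and
`log 0 = −∞`. -/
noncomputable def fcvxE {A G : Type*} [Fintype A] [Fintype G]
    (v : A → G → ℝ) (w : A → ℝ) (b : A → G → ℝ) : EReal :=
  (∑ i, ∑ j, if b i j = 0 then (0 : EReal) else ((w i * b i j : ℝ) : EReal) * elog (v i j))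
    - ((∑ j, (∑ i, w i * b i j) * Real.log (∑ i, w i * b i j) : ℝ) : EReal)
    + ((∑ i, w i * Real.log (w i) : ℝ) : EReal)

theorem elog_of_pos {x : ℝ} (hx : 0 < x) : elog x = (Real.log x : EReal) :=
  if_neg hx.not_ge

theorem EReal.coe_finsetSum {ι : Type*} (s : Finset ι) (f : ι → ℝ) :
    ((∑ i ∈ s, f i : ℝ) : EReal) = ∑ i ∈ s, (f i : EReal) := by
  classical
  induction s using Finset.induction_on with
  | empty => simp
  | insert i s hi ih => rw [sum_insert hi, sum_insert hi, EReal.coe_add, ih]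

theorem EReal.finsetSum_eq_bot {ι : Type*} {s : Finset ι} {f : ι → EReal} {i : ι} (hi : i ∈ s)
    (h : f i = ⊥) : ∑ i ∈ s, f i = ⊥ := by
  classical
  rw [← add_sum_erase s f hi, h, EReal.bot_add]

/-- A fractional selection of `n` items is worth at least the cheapest selection of `n` items. -/
theorem sum_mul_nonneg_of_forall_card_eq {G : Type*} [Fintype G] {n : ℕ} (hn : 0 < n)
    {c z : G → ℝ} (hc0 : ∀ j, 0 ≤ c j) (hc1 : ∀ j, c j ≤ 1) (hc : ∑ j, c j = n)
    (hz : ∀ S : Finset G, S.card = n → 0 ≤ ∑ j ∈ S, z j) : 0 ≤ ∑ j, c j * z j := by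
  classical
  have hcard : n ≤ (univ : Finset G).card := by
    have h : ∑ j, c j ≤ ∑ _j : G, (1 : ℝ) := sum_le_sum fun j _ => hc1 j
    rw [hc, sum_const, nsmul_eq_mul, mul_one] at h
    exact_mod_cast h
  obtain ⟨S, hS, hmin⟩ := exists_min_image (powersetCard n (univ : Finset G))
    (fun S => ∑ j ∈ S, z j) (powersetCard_nonempty.2 hcard)
  rw [mem_powersetCard_univ] at hS
  obtain ⟨k, hkS, hk⟩ := exists_max_image S z (card_pos.1 (hS ▸ hn))
  have hout : ∀ j, j ∉ S → z k ≤ z j := by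
    intro j hj
    have hjS : j ∉ S.erase k := fun h => hj (mem_of_mem_erase h)
    have h := hmin (insert j (S.erase k)) (by
      rw [mem_powersetCard_univ, card_insert_of_notMem hjS, card_erase_of_mem hkS]
      omega)
    rw [sum_insert hjS, ← add_sum_erase S z hkS] at h
    linarith
  have hterm : ∀ j, (if j ∈ S then z j - z k else 0) ≤ c j * (z j - z k) := by
    intro j
    split_ifs with hj
    · nlinarith [hk j hj, hc1 j]
    · exact mul_nonneg (hc0 j) (sub_nonneg.2 (hout j hj))
  have hsum := sum_le_sum fun j (_ : j ∈ univ) => hterm j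
  rw [sum_ite_mem, univ_inter, sum_sub_distrib, sum_const, hS, nsmul_eq_mul] at hsum
  simp only [mul_sub, sum_sub_distrib, ← sum_mul, hc] at hsum
  linarith [hz S hS]

theorem Real.mul_log_add_negMulLog_le {b s : ℝ} (hb : 0 ≤ b) (hs : 0 ≤ s) (h : b ≠ 0 → 0 < s) :
    b * Real.log s + Real.negMulLog b ≤ s - b := by
  rcases hb.eq_or_lt with rfl | hb
  · simpa using hs
  · have hs := h hb.ne'
    have h1 := Real.log_le_sub_one_of_pos (div_pos hs hb)
    rw [Real.log_div hs.ne' hb.ne'] at h1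
    have h2 := mul_le_mul_of_nonneg_left h1 hb.le
    rw [mul_sub b (s / b), mul_div_cancel₀ _ hb.ne'] at h2
    rw [Real.negMulLog]
    linarith

/-- Gibbs' variational inequality. -/
theorem Real.sum_mul_log_add_negMulLog_le_log_sum {G : Type*} [Fintype G] {b p : G → ℝ}
    (hb : ∀ j, 0 ≤ b j) (hb1 : ∑ j, b j = 1) (hp : ∀ j, 0 ≤ p j) (h : ∀ j, b j ≠ 0 → 0 < p j)
    (hpos : 0 < ∑ j, p j) :
    ∑ j, (b j * Real.log (p j) + Real.negMulLog (b j)) ≤ Real.log (∑ j, p j) := by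
  set N := ∑ j, p j
  have hterm : ∀ j, b j * Real.log (p j) + Real.negMulLog (b j)
      ≤ p j / N - b j + b j * Real.log N := by
    intro j
    have h1 := Real.mul_log_add_negMulLog_le (hb j) (div_nonneg (hp j) hpos.le)
      fun hj => div_pos (h j hj) hpos
    rcases eq_or_ne (b j) 0 with hj | hj
    · simpa [hj] using h1
    · rw [Real.log_div (h j hj).ne' hpos.ne'] at h1
      linarith
  refine (sum_le_sum fun j _ => hterm j).trans_eq ?_
  rw [sum_add_distrib, sum_sub_distrib, ← sum_div, ← sum_mul, hb1, div_self hpos.ne']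
  ring

/-- The normalized weights attain equality in Gibbs' variational inequality. -/
theorem Real.sum_normalize_mul_log_add_negMulLog {G : Type*} [Fintype G] {p : G → ℝ}
    (hp : ∀ j, 0 ≤ p j) (hpos : 0 < ∑ j, p j) :
    ∑ j, (p j / (∑ k, p k) * Real.log (p j) + Real.negMulLog (p j / ∑ k, p k))
      = Real.log (∑ j, p j) := by
  set N := ∑ j, p j
  have hterm : ∀ j, p j / N * Real.log (p j) + Real.negMulLog (p j / N)
      = p j / N * Real.log N := by
    intro j
    rcases (hp j).eq_or_lt with hj | hj
    · simp [← hj]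
    · rw [Real.negMulLog, Real.log_div hj.ne' hpos.ne']
      ring
  rw [sum_congr rfl fun j _ => hterm j, ← sum_mul, ← sum_div, div_self hpos.ne', one_mul]

/-- Minimax for a concave-linear function with one compact domain: if every `z` admits a `b` with
`T ≤ Φ b z`, then a single `b` works for all `z`. -/
theorem exists_forall_le_of_forall_exists_le {E F : Type*}
    [TopologicalSpace E] [AddCommGroup E] [Module ℝ E] [IsTopologicalAddGroup E]
    [ContinuousSMul ℝ E] [T2Space E] [TopologicalSpace F] [AddCommGroup F] [Module ℝ F]
    [IsTopologicalAddGroup F] [ContinuousSMul ℝ F] {K : Set E} {Z : Set F} {Φ : E → F → ℝ}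
    (hKne : K.Nonempty) (hK : Convex ℝ K) (hKc : IsCompact K) (hZ : Convex ℝ Z)
    (hcont : ∀ z ∈ Z, Continuous fun b => Φ b z) (hconc : ∀ z ∈ Z, ConcaveOn ℝ K fun b => Φ b z)
    (hcont' : ∀ b ∈ K, Continuous (Φ b)) (hconv : ∀ b ∈ K, ConvexOn ℝ Z (Φ b))
    {T : ℝ} (h : ∀ z ∈ Z, ∃ b ∈ K, T ≤ Φ b z) : ∃ b ∈ K, ∀ z ∈ Z, T ≤ Φ b z := by
  have hfin : ∀ u : Finset Z, (K ∩ ⋂ z ∈ u, {b | T ≤ Φ b z}).Nonempty := by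
    intro u
    by_contra hu
    obtain ⟨z, hz, hlt⟩ := Sion.exists_lt_iInf_of_lt_iInf_of_finite (X := K) (Y := Z)
      (f := fun b z => -Φ b z) (s := Subtype.val '' (u : Set Z)) (t := -T) hKne hKc
      (fun z hz => (hcont z hz).neg.lowerSemicontinuous.lowerSemicontinuousOn _)
      (fun z hz => (hconc z hz).neg.quasiconvexOn) hZ
      (fun b hb => (hcont' b hb).neg.upperSemicontinuous.upperSemicontinuousOn _)
      (fun b hb => (hconv b hb).neg.quasiconcaveOn) hK
      (u.finite_toSet.image _) (by rintro _ ⟨z, -, rfl⟩; exact z.2) (by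
        intro b hb
        by_contra! hc
        refine hu ⟨b, hb, Set.mem_iInter₂.2 fun z hz => ?_⟩
        simpa using hc z ⟨z, hz, rfl⟩)
    obtain ⟨b, hb, hTb⟩ := h z hz
    exact (hlt b hb).not_ge (neg_le_neg hTb)
  obtain ⟨b, hb, hbz⟩ := hKc.inter_iInter_nonempty (fun z : Z => {b | T ≤ Φ b z})
    (fun z => isClosed_le continuous_const (hcont z z.2)) hfin
  exact ⟨b, hb, fun z hz => Set.mem_iInter.1 hbz ⟨z, hz⟩⟩

/-- Row-stochastic matrices supported on the nonzero entries of `a`. -/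
def supportedRowStochastic {A G : Type*} [Fintype G] (a : A → G → ℝ) : Set (A → G → ℝ) :=
  {b | (∀ i, b i ∈ stdSimplex ℝ G) ∧ ∀ i j, a i j = 0 → b i j = 0}

/-- The Lagrangian obtained from the log-concave program by Gibbs' variational principle, with
`z = log y` and `a i j = x i j * v i j`. -/
noncomputable def gibbsLagrangian {A G : Type*} [Fintype A] [Fintype G] (w : A → ℝ)
    (a b : A → G → ℝ) (z : G → ℝ) : ℝ :=
  ∑ i, ∑ j, (w i * (b i j * Real.log (a i j) + Real.negMulLog (b i j)) + b i j * z j)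

theorem convex_supportedRowStochastic {A G : Type*} [Fintype G] (a : A → G → ℝ) :
    Convex ℝ (supportedRowStochastic a) := by
  intro b hb b' hb' s t hs ht hst
  refine ⟨fun i => convex_stdSimplex ℝ G (hb.1 i) (hb'.1 i) hs ht hst, fun i j h => ?_⟩
  simp [hb.2 i j h, hb'.2 i j h]

theorem isCompact_supportedRowStochastic {A G : Type*} [Fintype G] (a : A → G → ℝ) :
    IsCompact (supportedRowStochastic a) := by
  have h : supportedRowStochastic a
      = Set.univ.pi (fun _ => stdSimplex ℝ G) ∩ ⋂ i, ⋂ j, {b | a i j = 0 → b i j = 0} := by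
    ext b
    simp [supportedRowStochastic]
  rw [h]
  refine (isCompact_univ_pi fun _ => isCompact_stdSimplex ℝ G).inter_right
    (isClosed_iInter fun i => isClosed_iInter fun j => isClosed_imp isOpen_const ?_)
  exact isClosed_eq (by fun_prop) continuous_const

theorem concaveOn_gibbsLagrangian {A G : Type*} [Fintype A] [Fintype G] {w : A → ℝ}
    (hw : ∀ i, 0 ≤ w i) (a : A → G → ℝ) (z : G → ℝ) :
    ConcaveOn ℝ (supportedRowStochastic a) fun b => gibbsLagrangian w a b z := by
  refine ⟨convex_supportedRowStochastic a, fun b hb b' hb' s t hs ht hst => ?_⟩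
  simp only [gibbsLagrangian, smul_eq_mul, mul_sum, ← sum_add_distrib]
  refine sum_le_sum fun i _ => sum_le_sum fun j _ => ?_
  have h := mul_le_mul_of_nonneg_left (Real.concaveOn_negMulLog.2 (Set.mem_Ici.2 ((hb.1 i).1 j))
    (Set.mem_Ici.2 ((hb'.1 i).1 j)) hs ht hst) (hw i)
  simp only [smul_eq_mul, Pi.add_apply, Pi.smul_apply] at h ⊢
  linarith

theorem convexOn_gibbsLagrangian {A G : Type*} [Fintype A] [Fintype G] (w : A → ℝ)
    (a b : A → G → ℝ) {Z : Set (G → ℝ)} (hZ : Convex ℝ Z) :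
    ConvexOn ℝ Z (gibbsLagrangian w a b) := by
  refine ⟨hZ, fun z _ z' _ s t _ _ hst => le_of_eq ?_⟩
  simp only [gibbsLagrangian, smul_eq_mul, mul_sum, ← sum_add_distrib]
  refine sum_congr rfl fun i _ => sum_congr rfl fun j _ => ?_
  obtain rfl : t = 1 - s := by linarith
  simp only [Pi.add_apply, Pi.smul_apply, smul_eq_mul]
  ring

theorem gibbsLagrangian_eq_add {A G : Type*} [Fintype A] [Fintype G] (w : A → ℝ)
    (a b : A → G → ℝ) (z : G → ℝ) :
    gibbsLagrangian w a b z = gibbsLagrangian w a b 0 + ∑ j, (∑ i, b i j) * z j := by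
  simp only [gibbsLagrangian, sum_add_distrib, Pi.zero_apply, mul_zero, add_zero,
    sum_mul]
  rw [sum_comm (f := fun i j => b i j * z j)]

theorem fcvxE_eq_coe {A G : Type*} [Fintype A] [Fintype G] {v : A → G → ℝ} {w : A → ℝ}
    {b : A → G → ℝ} (h : ∀ i j, b i j ≠ 0 → 0 < v i j) :
    fcvxE v w b = ((∑ i, ∑ j, w i * b i j * Real.log (v i j)
      - ∑ j, (∑ i, w i * b i j) * Real.log (∑ i, w i * b i j)
      + ∑ i, w i * Real.log (w i) : ℝ) : EReal) := by
  rw [fcvxE, EReal.coe_add, EReal.coe_sub,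
    EReal.coe_finsetSum univ fun i => ∑ j, w i * b i j * Real.log (v i j)]
  congr 2
  refine sum_congr rfl fun i _ => ?_
  rw [EReal.coe_finsetSum]
  refine sum_congr rfl fun j _ => ?_
  split_ifs with hb
  · simp [hb]
  · rw [elog_of_pos (h i j hb), ← EReal.coe_mul]

theorem fcvxE_eq_bot {A G : Type*} [Fintype A] [Fintype G] {v : A → G → ℝ} {w : A → ℝ}
    {b : A → G → ℝ} {i : A} {j : G} (hw : 0 < w i) (hb : 0 < b i j) (hv : v i j ≤ 0) :
    fcvxE v w b = ⊥ := by
  rw [fcvxE, EReal.finsetSum_eq_bot (mem_univ i), EReal.bot_sub, EReal.bot_add]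
  refine EReal.finsetSum_eq_bot (mem_univ j) ?_
  rw [if_neg hb.ne', elog, if_pos hv, EReal.coe_mul_bot_of_pos (mul_pos hw hb)]

/-- A lower bound for the log-concave objective at the allocation proportional to `w i * b i j`. -/
theorem fcvx_le_sum_log {A G : Type*} [Fintype A] [Fintype G] {v : A → G → ℝ} {w : A → ℝ}
    {b x : A → G → ℝ} {y : G → ℝ} (hv : ∀ i j, 0 ≤ v i j) (hw : ∀ i, 0 < w i)
    (hb0 : ∀ i j, 0 ≤ b i j) (hb1 : ∀ i, ∑ j, b i j = 1) (hvb : ∀ i j, b i j ≠ 0 → 0 < v i j)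
    (hx : ∀ i j, 0 ≤ x i j)
    (hxb : ∀ i j, b i j ≠ 0 → x i j = w i * b i j / ∑ k, w k * b k j)
    (hy : ∀ j, 0 < y j) (hby : 0 ≤ ∑ j, (∑ i, b i j) * Real.log (y j)) :
    (∀ i, 0 < ∑ j, x i j * v i j * y j ^ (1 / w i)) ∧
    ∑ i, ∑ j, w i * b i j * Real.log (v i j)
      - ∑ j, (∑ i, w i * b i j) * Real.log (∑ i, w i * b i j) + ∑ i, w i * Real.log (w i)
      ≤ ∑ i, w i * Real.log (∑ j, x i j * v i j * y j ^ (1 / w i)) := by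
  have hpos : ∀ i j, b i j ≠ 0 → 0 < b i j := fun i j h => (hb0 i j).lt_of_ne' h
  have hq : ∀ i j, b i j ≠ 0 → 0 < ∑ k, w k * b k j := fun i j h =>
    (mul_pos (hw i) (hpos i j h)).trans_le
      (single_le_sum (f := fun k => w k * b k j) (fun k _ => mul_nonneg (hw k).le (hb0 k j))
        (mem_univ i))
  have hxpos : ∀ i j, b i j ≠ 0 → 0 < x i j := fun i j h => by
    rw [hxb i j h]
    exact div_pos (mul_pos (hw i) (hpos i j h)) (hq i j h)
  have hp0 : ∀ i j, 0 ≤ x i j * v i j * y j ^ (1 / w i) := fun i j =>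
    mul_nonneg (mul_nonneg (hx i j) (hv i j)) (Real.rpow_nonneg (hy j).le _)
  have hp : ∀ i j, b i j ≠ 0 → 0 < x i j * v i j * y j ^ (1 / w i) := fun i j h =>
    mul_pos (mul_pos (hxpos i j h) (hvb i j h)) (Real.rpow_pos_of_pos (hy j) _)
  have hrow : ∀ i, 0 < ∑ j, x i j * v i j * y j ^ (1 / w i) := by
    intro i
    obtain ⟨j, -, hj⟩ := exists_ne_zero_of_sum_ne_zero ((hb1 i).symm ▸ one_ne_zero)
    exact sum_pos' (fun j _ => hp0 i j) ⟨j, mem_univ j, hp i j hj⟩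
  refine ⟨hrow, ?_⟩
  have hterm : ∀ i j, w i * (b i j * Real.log (x i j * v i j * y j ^ (1 / w i))
        + Real.negMulLog (b i j))
      = w i * b i j * Real.log (v i j) + b i j * (w i * Real.log (w i))
        - w i * b i j * Real.log (∑ k, w k * b k j) + b i j * Real.log (y j) := by
    intro i j
    rcases eq_or_ne (b i j) 0 with h | h
    · simp [h]
    · rw [Real.log_mul (mul_pos (hxpos i j h) (hvb i j h)).ne'
        (Real.rpow_pos_of_pos (hy j) _).ne', Real.log_mul (hxpos i j h).ne' (hvb i j h).ne',
        Real.log_rpow (hy j), hxb i j h,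
        Real.log_div (mul_pos (hw i) (hpos i j h)).ne' (hq i j h).ne',
        Real.log_mul (hw i).ne' h, Real.negMulLog]
      field_simp [(hw i).ne']
      ring
  have hgibbs : ∑ i, ∑ j, w i * (b i j * Real.log (x i j * v i j * y j ^ (1 / w i))
        + Real.negMulLog (b i j)) ≤ ∑ i, w i * Real.log (∑ j, x i j * v i j * y j ^ (1 / w i)) := by
    refine sum_le_sum fun i _ => ?_
    rw [← mul_sum]
    exact mul_le_mul_of_nonneg_left (Real.sum_mul_log_add_negMulLog_le_log_sum (hb0 i) (hb1 i)
      (hp0 i) (hp i) (hrow i)) (hw i).le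
  refine le_trans ?_ hgibbs
  simp only [hterm, sum_add_distrib, sum_sub_distrib, ← sum_mul, hb1, one_mul]
  rw [sum_comm (f := fun i j => w i * b i j * Real.log (∑ k, w k * b k j)),
    sum_comm (f := fun i j => b i j * Real.log (y j))]
  simp only [← sum_mul]
  linarith

theorem gibbsLagrangian_zero_le_fcvx {A G : Type*} [Fintype A] [Fintype G] {v : A → G → ℝ}
    {w : A → ℝ} {b x : A → G → ℝ} (hw : ∀ i, 0 < w i)
    (hb0 : ∀ i j, 0 ≤ b i j) (hb1 : ∀ i, ∑ j, b i j = 1) (hvb : ∀ i j, b i j ≠ 0 → 0 < v i j)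
    (hx0 : ∀ i j, 0 ≤ x i j) (hx1 : ∀ j, ∑ i, x i j = 1) (hxb : ∀ i j, b i j ≠ 0 → 0 < x i j) :
    gibbsLagrangian w (fun i j => x i j * v i j) b 0
      ≤ ∑ i, ∑ j, w i * b i j * Real.log (v i j)
        - ∑ j, (∑ i, w i * b i j) * Real.log (∑ i, w i * b i j)
        + ∑ i, w i * Real.log (w i) := by
  set q : G → ℝ := fun j => ∑ k, w k * b k j
  have hwb : ∀ i j, 0 ≤ w i * b i j := fun i j => mul_nonneg (hw i).le (hb0 i j)
  have hq0 : ∀ j, 0 ≤ q j := fun j => sum_nonneg fun k _ => hwb k j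
  have hq : ∀ i j, b i j ≠ 0 → 0 < q j := fun i j h =>
    (mul_pos (hw i) ((hb0 i j).lt_of_ne' h)).trans_le
      (single_le_sum (f := fun k => w k * b k j) (fun k _ => hwb k j) (mem_univ i))
  have hterm : ∀ i j, w i * (b i j * Real.log (x i j * v i j) + Real.negMulLog (b i j))
        + b i j * (0 : G → ℝ) j
      ≤ w i * b i j * Real.log (v i j) - w i * b i j * Real.log (q j)
        + b i j * (w i * Real.log (w i)) + (x i j * q j - w i * b i j) := by
    intro i j
    have hle := Real.mul_log_add_negMulLog_le (hwb i j) (mul_nonneg (hx0 i j) (hq0 j)) fun h =>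
      mul_pos (hxb i j (right_ne_zero_of_mul h)) (hq i j (right_ne_zero_of_mul h))
    rcases eq_or_ne (b i j) 0 with h | h
    · simpa [h] using hle
    · rw [Real.negMulLog, Real.log_mul (hw i).ne' h, Real.log_mul (hxb i j h).ne' (hq i j h).ne']
        at hle
      rw [Real.log_mul (hxb i j h).ne' (hvb i j h).ne', Real.negMulLog, Pi.zero_apply]
      linarith
  refine (sum_le_sum fun i _ => sum_le_sum fun j _ => hterm i j).trans_eq ?_
  simp only [sum_add_distrib, sum_sub_distrib, ← sum_mul, hb1, one_mul]
  rw [sum_comm (f := fun i j => x i j * q j), sum_comm (f := fun i j => w i * b i j),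
    sum_comm (f := fun i j => w i * b i j * Real.log (q j))]
  simp only [← sum_mul, hx1, one_mul]
  simp only [q]
  ring

/-- Linear functionals bounded below on the cone dual to the `n`-element sets have coefficients
at most `1`. -/
theorem le_one_of_forall_le_add_sum_mul {G : Type*} [Fintype G] {n : ℕ} (hn : 0 < n)
    {c : G → ℝ} (hc : ∑ j, c j = n) {F T : ℝ}
    (h : ∀ z : G → ℝ, (∀ S : Finset G, S.card = n → 0 ≤ ∑ j ∈ S, z j) →
      T ≤ F + ∑ j, c j * z j) (j : G) : c j ≤ 1 := by
  classical
  by_contra! hj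
  have hn' : (0 : ℝ) < n := by exact_mod_cast hn
  obtain ⟨s, hs⟩ := exists_gt (max 0 ((F - T) / (n * (c j - 1))))
  have hs0 : 0 < s := (le_max_left _ _).trans_lt hs
  have hsT := (le_max_right _ _).trans_lt hs
  rw [div_lt_iff₀ (mul_pos hn' (sub_pos.2 hj))] at hsT
  have h1 := h (fun k => s - if k = j then n * s else 0) (by
    intro S hS
    rw [sum_sub_distrib, sum_const, hS, nsmul_eq_mul, sum_ite_eq']
    split_ifs
    · simp
    · simp only [sub_zero]; positivity)
  simp only [mul_sub, sum_sub_distrib, ← sum_mul, hc, mul_ite, mul_zero, sum_ite_eq', mem_univ,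
    if_true] at h1
  nlinarith

theorem exists_le_fcvx_of_forall_lt {A G : Type*} [Fintype A] [Nonempty A] [Fintype G]
    {v : A → G → ℝ} {w : A → ℝ} {x : A → G → ℝ} {T : ℝ}
    (hv : ∀ i j, 0 ≤ v i j) (hw : ∀ i, 0 < w i)
    (hx0 : ∀ i j, 0 ≤ x i j) (hx1 : ∀ j, ∑ i, x i j = 1)
    (h : ∀ y : G → ℝ, (∀ j, 0 < y j) →
      (∀ S : Finset G, S.card = Fintype.card A → 1 ≤ ∏ j ∈ S, y j) →
      (T : EReal) < ∑ i, ((w i : ℝ) : EReal) * elog (∑ j, x i j * v i j * y j ^ (1 / w i))) :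
    ∃ b : A → G → ℝ, (∀ i j, 0 ≤ b i j) ∧ (∀ i, ∑ j, b i j = 1) ∧ (∀ j, ∑ i, b i j ≤ 1) ∧
      (T : EReal) ≤ fcvxE v w b := by
  set Z : Set (G → ℝ) :=
    {z | ∀ S : Finset G, S.card = Fintype.card A → 0 ≤ ∑ j ∈ S, z j}
  have hZ : Convex ℝ Z := by
    intro z hz z' hz' s t hs ht _ S hS
    simp only [Pi.add_apply, Pi.smul_apply, smul_eq_mul, sum_add_distrib, ← mul_sum]
    exact add_nonneg (mul_nonneg hs (hz S hS)) (mul_nonneg ht (hz' S hS))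
  set a : A → G → ℝ := fun i j => x i j * v i j
  have ha0 : ∀ i j, 0 ≤ a i j := fun i j => mul_nonneg (hx0 i j) (hv i j)
  have hexists : ∀ z ∈ Z, ∃ b ∈ supportedRowStochastic a, T ≤ gibbsLagrangian w a b z := by
    intro z hz
    have hlt := h (fun j => Real.exp (z j)) (fun j => Real.exp_pos _) (fun S hS => by
      rw [← Real.exp_sum]
      exact Real.one_le_exp (hz S hS))
    set p : A → G → ℝ := fun i j => x i j * v i j * Real.exp (z j) ^ (1 / w i) with hpdef
    have hp0 : ∀ i j, 0 ≤ p i j := fun i j =>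
      mul_nonneg (ha0 i j) (Real.rpow_nonneg (Real.exp_pos _).le _)
    have hrow : ∀ i, 0 < ∑ j, p i j := by
      intro i
      by_contra hi
      rw [EReal.finsetSum_eq_bot (mem_univ i)] at hlt
      · exact not_lt_bot hlt
      · rw [elog, if_pos (not_lt.1 hi), EReal.coe_mul_bot_of_pos (hw i)]
    refine ⟨fun i j => p i j / ∑ k, p i k,
      ⟨fun i => ⟨fun j => div_nonneg (hp0 i j) (hrow i).le, ?_⟩,
      fun i j hij => ?_⟩, ?_⟩
    · rw [← sum_div, div_self (hrow i).ne']
    · have hzero : p i j = 0 := by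
        have : x i j * v i j = 0 := hij
        simp [hpdef, this]
      simp [hzero]
    · have hlog : T < ∑ i, w i * Real.log (∑ j, p i j) := by
        rw [← EReal.coe_lt_coe_iff, EReal.coe_finsetSum]
        refine hlt.trans_eq (sum_congr rfl fun i _ => ?_)
        rw [elog_of_pos (hrow i), EReal.coe_mul]
      refine hlog.le.trans_eq (sum_congr rfl fun i _ => ?_)
      rw [← Real.sum_normalize_mul_log_add_negMulLog (hp0 i) (hrow i), mul_sum]
      refine sum_congr rfl fun j _ => ?_
      rcases (ha0 i j).eq_or_lt with hij | hij
      · have hzero : p i j = 0 := by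
          have : x i j * v i j = 0 := hij.symm
          simp [hpdef, this]
        simp [hzero]
      · have hl : Real.log (p i j) = Real.log (a i j) + 1 / w i * z j := by
          rw [hpdef]
          change Real.log (a i j * Real.exp (z j) ^ (1 / w i)) = _
          rw [Real.log_mul hij.ne' (Real.rpow_pos_of_pos (Real.exp_pos _) _).ne',
            Real.log_rpow (Real.exp_pos _), Real.log_exp]
        rw [hl]
        have := (hw i).ne'
        field_simp
        ring
  have hZ0 : (0 : G → ℝ) ∈ Z := fun S _ => by simp
  obtain ⟨b, hb, hTb⟩ := exists_forall_le_of_forall_exists_le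
    (let ⟨b, hb, _⟩ := hexists 0 hZ0; ⟨b, hb⟩) (convex_supportedRowStochastic a)
    (isCompact_supportedRowStochastic a) hZ
    (fun z _ => by unfold gibbsLagrangian; fun_prop)
    (fun z _ => concaveOn_gibbsLagrangian (fun i => (hw i).le) a z)
    (fun b _ => by unfold gibbsLagrangian; fun_prop)
    (fun b _ => convexOn_gibbsLagrangian w a b hZ) hexists
  have hb0 : ∀ i j, 0 ≤ b i j := fun i => (hb.1 i).1
  have hb1 : ∀ i, ∑ j, b i j = 1 := fun i => (hb.1 i).2
  have hab : ∀ i j, b i j ≠ 0 → a i j ≠ 0 := fun i j h h' => h (hb.2 i j h')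
  have hvb : ∀ i j, b i j ≠ 0 → 0 < v i j := fun i j hij =>
    (hv i j).lt_of_ne' (right_ne_zero_of_mul (hab i j hij))
  have hxb : ∀ i j, b i j ≠ 0 → 0 < x i j := fun i j hij =>
    (hx0 i j).lt_of_ne' (left_ne_zero_of_mul (hab i j hij))
  refine ⟨b, hb0, hb1, le_one_of_forall_le_add_sum_mul (n := Fintype.card A)
    (F := gibbsLagrangian w a b 0) (T := T) Fintype.card_pos ?_ (fun z hz => ?_), ?_⟩
  · rw [sum_comm]
    simp [hb1]
  · rw [← gibbsLagrangian_eq_add]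
    exact hTb z hz
  · rw [fcvxE_eq_coe hvb, EReal.coe_le_coe_iff]
    exact (hTb 0 hZ0).trans (gibbsLagrangian_zero_le_fcvx hw hb0 hb1 hvb hx0 hx1 hxb)

theorem exists_forall_fcvxE_le {A G : Type*} [Fintype A] [Nonempty A] [Fintype G]
    {v : A → G → ℝ} {w : A → ℝ} {b : A → G → ℝ}
    (hv : ∀ i j, 0 ≤ v i j) (hw : ∀ i, 0 < w i) (hws : ∑ i, w i = 1)
    (hb0 : ∀ i j, 0 ≤ b i j) (hb1 : ∀ i, ∑ j, b i j = 1) (hb2 : ∀ j, ∑ i, b i j ≤ 1) :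
    ∃ x : A → G → ℝ, ((∀ i j, 0 ≤ x i j) ∧ ∀ j, ∑ i, x i j = 1) ∧
      ∀ y : G → ℝ, (∀ j, 0 < y j) →
      (∀ S : Finset G, S.card = Fintype.card A → 1 ≤ ∏ j ∈ S, y j) →
      fcvxE v w b ≤ ∑ i, ((w i : ℝ) : EReal) * elog (∑ j, x i j * v i j * y j ^ (1 / w i)) := by
  classical
  have hwb : ∀ i j, 0 ≤ w i * b i j := fun i j => mul_nonneg (hw i).le (hb0 i j)
  set x : A → G → ℝ := fun i j =>
    if ∑ k, w k * b k j = 0 then w i else w i * b i j / ∑ k, w k * b k j with hxdef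
  have hx0 : ∀ i j, 0 ≤ x i j := by
    intro i j
    simp only [hxdef]
    split_ifs
    · exact (hw i).le
    · exact div_nonneg (hwb i j) (sum_nonneg fun k _ => hwb k j)
  have hx1 : ∀ j, ∑ i, x i j = 1 := by
    intro j
    simp only [hxdef]
    split_ifs with hj
    · exact hws
    · rw [← sum_div, div_self hj]
  have hxb : ∀ i j, b i j ≠ 0 → x i j = w i * b i j / ∑ k, w k * b k j := by
    intro i j hij
    refine if_neg fun hj => ?_
    have := (sum_eq_zero_iff_of_nonneg fun k _ => hwb k j).1 hj i (mem_univ i)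
    exact mul_ne_zero (hw i).ne' hij this
  refine ⟨x, ⟨hx0, hx1⟩, fun y hy hyS => ?_⟩
  by_cases hvb : ∀ i j, b i j ≠ 0 → 0 < v i j
  · have hby : 0 ≤ ∑ j, (∑ i, b i j) * Real.log (y j) := by
      refine sum_mul_nonneg_of_forall_card_eq (n := Fintype.card A) Fintype.card_pos
        (fun j => sum_nonneg fun i _ => hb0 i j) hb2 ?_ fun S hS => ?_
      · rw [sum_comm]
        simp [hb1]
      · rw [← Real.log_prod fun j _ => (hy j).ne']
        exact Real.log_nonneg (hyS S hS)
    obtain ⟨hrow, hle⟩ := fcvx_le_sum_log hv hw hb0 hb1 hvb hx0 hxb hy hby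
    rw [fcvxE_eq_coe hvb]
    refine (EReal.coe_le_coe_iff.2 hle).trans_eq ?_
    rw [EReal.coe_finsetSum]
    refine sum_congr rfl fun i _ => ?_
    rw [elog_of_pos (hrow i), EReal.coe_mul]
  · push Not at hvb
    obtain ⟨i, j, hij, hvij⟩ := hvb
    rw [fcvxE_eq_bot (hw i) ((hb0 i j).lt_of_ne' hij) hvij]
    exact bot_le

/-- Under the matching assumption,
`sup_{x∈X} inf_{y∈Q} Σ_i w_i log(Σ_j x_{ij} v_{ij} y_j^{1/w_i}) = sup_{b∈P(𝒜,𝒢)} f_cvx(b)`;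
the optimal values of the weighted log-concave program and of CVX-Weighted are the same. -/
theorem weighted_relaxations_equal
    (A G : Type*) [Fintype A] [Fintype G]
    (v : A → G → ℝ) (w : A → ℝ)
    (hv : ∀ i j, 0 ≤ v i j) (hw : ∀ i, 0 < w i) (hws : ∑ i, w i = 1)
    (hmatch : ∃ f : A → G, Function.Injective f ∧ ∀ i, 0 < v i (f i)) :
    (⨆ x ∈ {x : A → G → ℝ | (∀ i j, 0 ≤ x i j) ∧ ∀ j, ∑ i, x i j = 1},
      ⨅ y ∈ {y : G → ℝ | (∀ j, 0 < y j) ∧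
          ∀ S : Finset G, S.card = Fintype.card A → 1 ≤ ∏ j ∈ S, y j},
        ∑ i, ((w i : ℝ) : EReal) * elog (∑ j, x i j * v i j * y j ^ (1 / w i)))
    = ⨆ b ∈ {b : A → G → ℝ |
          (∀ i j, 0 ≤ b i j) ∧ (∀ i, ∑ j, b i j = 1) ∧ (∀ j, ∑ i, b i j ≤ 1)},
        fcvxE v w b := by
  have : Nonempty A := by
    by_contra hA
    rw [not_nonempty_iff] at hA
    simp at hws
  apply le_antisymm
  · refine iSup₂_le fun x hx => EReal.ge_of_forall_gt_iff_ge.1 fun T hT => ?_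
    obtain ⟨b, hb0, hb1, hb2, hTb⟩ := exists_le_fcvx_of_forall_lt hv hw hx.1 hx.2
      fun y hy hyS => hT.trans_le (iInf₂_le y ⟨hy, hyS⟩)
    exact hTb.trans (le_iSup₂ (f := fun b _ => fcvxE v w b) b ⟨hb0, hb1, hb2⟩)
  · refine iSup₂_le fun b hb => ?_
    obtain ⟨x, hx, hle⟩ := exists_forall_fcvxE_le hv hw hws hb.1 hb.2.1 hb.2.2
    exact le_iSup₂_of_le x hx (le_iInf₂ fun y hy => hle y hy.1 hy.2)
end

section
/- Let b̄ be any feasible point in P(𝒜,𝒢). Then there exists an acyclic solution b^forest ∈ P(𝒜,𝒢) with b^forest_{ij} = 0 whenever b̄_{ij} = 0 (i.e., supported within the support of b̄) such that f_ncvx(b^forest) ≥ f_ncvx(b̄). -/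
open Finset

/-- The objective of the (non-convex) program NCVX-Weighted. -/
noncomputable def fncvx {A G : Type*} [Fintype A] [Fintype G]
    (v : A → G → ℝ) (w : A → ℝ) (b : A → G → ℝ) : ℝ :=
  (∑ i, ∑ j, w i * b i j * Real.log (v i j))
    - ∑ i, ∑ j, w i * b i j * Real.log (∑ i', b i' j)

section AcyclicImprovement

variable {A G : Type*}

lemma supportGraph_adj_inl_inr (b : A → G → ℝ) (i : A) (j : G) :
    (supportGraph b).Adj (Sum.inl i) (Sum.inr j) ↔ 0 < b i j := by
  simp [supportGraph]

lemma not_supportGraph_adj_inl_inl (b : A → G → ℝ) (i i' : A) :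
    ¬ (supportGraph b).Adj (Sum.inl i) (Sum.inl i') := by
  simp [supportGraph]

lemma not_supportGraph_adj_inr_inr (b : A → G → ℝ) (j j' : G) :
    ¬ (supportGraph b).Adj (Sum.inr j) (Sum.inr j') := by
  simp [supportGraph]

/-- A walk in a bipartite graph, with its edges signed by direction of traversal, gives a weight on
edges whose row and column sums vanish except at the endpoints of the walk. -/
lemma exists_signed_weight_of_walk [Fintype A] [Fintype G] [DecidableEq A] [DecidableEq G]
    {H : SimpleGraph (A ⊕ G)} (hA : ∀ i i', ¬ H.Adj (Sum.inl i) (Sum.inl i'))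
    (hG : ∀ j j', ¬ H.Adj (Sum.inr j) (Sum.inr j')) {x y : A ⊕ G} (p : H.Walk x y) :
    ∃ d : A → G → ℝ, (∀ i j, d i j ≠ 0 → H.Adj (Sum.inl i) (Sum.inr j)) ∧
      (∀ i, ∑ j, d i j = (if x = Sum.inl i then 1 else 0) - (if y = Sum.inl i then 1 else 0)) ∧
      (∀ j, ∑ i, d i j = (if y = Sum.inr j then 1 else 0) - (if x = Sum.inr j then 1 else 0)) := by
  induction p with
  | nil => exact ⟨0, by simp, by simp, by simp⟩
  | @cons x z y h q ih =>
    obtain ⟨d, hd, hrow, hcol⟩ := ih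
    rcases x with i₀ | j₀ <;> rcases z with i₁ | j₁
    · exact absurd h (hA _ _)
    · refine ⟨fun i j => d i j + if i₀ = i ∧ j₁ = j then 1 else 0, fun i j hij => ?_,
        fun i => ?_, fun j => ?_⟩
      · by_cases hc : i₀ = i ∧ j₁ = j
        · obtain ⟨rfl, rfl⟩ := hc
          exact h
        · exact hd i j (by simpa [hc] using hij)
      · simp [sum_add_distrib, hrow, ite_and]
        ring
      · simp [sum_add_distrib, hcol, ite_and]
    · refine ⟨fun i j => d i j - if i₁ = i ∧ j₀ = j then 1 else 0, fun i j hij => ?_,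
        fun i => ?_, fun j => ?_⟩
      · by_cases hc : i₁ = i ∧ j₀ = j
        · obtain ⟨rfl, rfl⟩ := hc
          exact h.symm
        · exact hd i j (by simpa [hc] using hij)
      · simp [sum_sub_distrib, hrow, ite_and]
      · simp [sum_sub_distrib, hcol, ite_and]
    · exact absurd h (hG _ _)

/-- A cycle in the support graph yields a nonzero direction, supported within the support, that
preserves all row and column sums. -/
lemma exists_balanced_direction_of_not_isAcyclic [Fintype A] [Fintype G] (b : A → G → ℝ)
    (hb : ¬ (supportGraph b).IsAcyclic) :
    ∃ d : A → G → ℝ, (∃ i j, d i j ≠ 0) ∧ (∀ i j, d i j ≠ 0 → 0 < b i j) ∧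
      (∀ i, ∑ j, d i j = 0) ∧ (∀ j, ∑ i, d i j = 0) := by
  classical
  have hedge : ∃ i j, 0 < b i j ∧
      ((supportGraph b).deleteEdges {s(Sum.inl i, Sum.inr j)}).Reachable
        (Sum.inl i) (Sum.inr j) := by
    rw [SimpleGraph.isAcyclic_iff_forall_adj_isBridge] at hb
    push Not at hb
    obtain ⟨x, y, hxy, hnb⟩ := hb
    rw [SimpleGraph.isBridge_iff, not_not] at hnb
    rcases x with i | j <;> rcases y with i' | j'
    · exact absurd hxy (not_supportGraph_adj_inl_inl _ _ _)
    · exact ⟨i, j', (supportGraph_adj_inl_inr _ _ _).1 hxy, hnb⟩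
    · exact ⟨i', j, (supportGraph_adj_inl_inr _ _ _).1 hxy.symm, by
        rw [Sym2.eq_swap]; exact hnb.symm⟩
    · exact absurd hxy (not_supportGraph_adj_inr_inr _ _ _)
  obtain ⟨i₀, j₀, hpos, ⟨p⟩⟩ := hedge
  obtain ⟨d, hd, hrow, hcol⟩ := exists_signed_weight_of_walk
    (fun i i' h => not_supportGraph_adj_inl_inl b i i' (SimpleGraph.deleteEdges_le _ h))
    (fun j j' h => not_supportGraph_adj_inr_inr b j j' (SimpleGraph.deleteEdges_le _ h)) p
  have hd₀ : d i₀ j₀ = 0 := by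
    by_contra h
    simpa [SimpleGraph.deleteEdges_adj] using hd i₀ j₀ h
  refine ⟨fun i j => d i j - if i₀ = i ∧ j₀ = j then 1 else 0, ⟨i₀, j₀, by simp [hd₀]⟩,
    fun i j hij => ?_, fun i => ?_, fun j => ?_⟩
  · by_cases hc : i₀ = i ∧ j₀ = j
    · obtain ⟨rfl, rfl⟩ := hc
      exact hpos
    · exact (supportGraph_adj_inl_inr b i j).1
        (SimpleGraph.deleteEdges_le _ (hd i j (by simpa [hc] using hij)))
  · simp [sum_sub_distrib, hrow, ite_and]
  · simp [sum_sub_distrib, hcol, ite_and]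

/-- The objective is affine along directions with vanishing column sums. -/
lemma fncvx_add_mul [Fintype A] [Fintype G] (v : A → G → ℝ) (w : A → ℝ) (b d : A → G → ℝ) (t : ℝ)
    (hcol : ∀ j, ∑ i, d i j = 0) :
    fncvx v w (fun i j => b i j + t * d i j) = fncvx v w b +
      t * ∑ i, ∑ j, w i * d i j * (Real.log (v i j) - Real.log (∑ i', b i' j)) := by
  have hq (j : G) : ∑ i, (b i j + t * d i j) = ∑ i, b i j := by
    rw [sum_add_distrib, ← mul_sum, hcol, mul_zero, add_zero]
  simp only [fncvx, hq, mul_sum, ← sum_sub_distrib, ← sum_add_distrib]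
  refine sum_congr rfl fun i _ => sum_congr rfl fun j _ => ?_
  ring

/-- Moving along a nonzero direction with vanishing row sums until a coordinate vanishes. -/
lemma exists_add_mul_nonneg_of_sum_eq_zero [Fintype A] [Fintype G] (b d : A → G → ℝ)
    (hb : ∀ i j, 0 ≤ b i j) (hne : ∃ i j, d i j ≠ 0) (hsupp : ∀ i j, d i j ≠ 0 → 0 < b i j)
    (hrow : ∀ i, ∑ j, d i j = 0) :
    ∃ t : ℝ, 0 ≤ t ∧ (∀ i j, 0 ≤ b i j + t * d i j) ∧
      ∃ i j, 0 < b i j ∧ b i j + t * d i j = 0 := by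
  classical
  have hneg : ∃ i j, d i j < 0 := by
    by_contra! h
    obtain ⟨i, j, hij⟩ := hne
    exact hij ((sum_eq_zero_iff_of_nonneg fun j _ => h i j).1 (hrow i) j (mem_univ j))
  let S : Finset (A × G) := univ.filter fun p => d p.1 p.2 < 0
  have hS : S.Nonempty := by
    obtain ⟨i, j, hij⟩ := hneg
    exact ⟨(i, j), by simpa [S] using hij⟩
  obtain ⟨⟨i₀, j₀⟩, hmem, hmin⟩ := S.exists_min_image (fun p => b p.1 p.2 / -d p.1 p.2) hS
  have h₀ : d i₀ j₀ < 0 := by simpa [S] using hmem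
  have ht : 0 ≤ b i₀ j₀ / -d i₀ j₀ := div_nonneg (hb _ _) (by linarith)
  refine ⟨b i₀ j₀ / -d i₀ j₀, ht, fun i j => ?_, i₀, j₀, hsupp _ _ h₀.ne, ?_⟩
  · rcases lt_or_ge (d i j) 0 with h | h
    · have := hmin (i, j) (by simpa [S] using h)
      rw [le_div_iff₀ (by simpa using h)] at this
      dsimp only at this
      linarith
    · exact add_nonneg (hb i j) (mul_nonneg ht h)
  · have := h₀.ne
    field_simp
    ring

/-- If the support graph contains a cycle, the support can be shrunk without decreasing the
objective. -/
lemma exists_smaller_support_of_not_isAcyclic [Fintype A] [Fintype G] (v : A → G → ℝ) (w : A → ℝ)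
    (b : A → G → ℝ) (hb : Feasible b) (hcyc : ¬ (supportGraph b).IsAcyclic) :
    ∃ b' : A → G → ℝ, Feasible b' ∧ (∀ i j, b i j = 0 → b' i j = 0) ∧
      (∃ i j, b i j ≠ 0 ∧ b' i j = 0) ∧ fncvx v w b ≤ fncvx v w b' := by
  obtain ⟨d, hne, hsupp, hrow, hcol, hobj⟩ : ∃ d : A → G → ℝ, (∃ i j, d i j ≠ 0) ∧
      (∀ i j, d i j ≠ 0 → 0 < b i j) ∧ (∀ i, ∑ j, d i j = 0) ∧ (∀ j, ∑ i, d i j = 0) ∧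
      0 ≤ ∑ i, ∑ j, w i * d i j * (Real.log (v i j) - Real.log (∑ i', b i' j)) := by
    obtain ⟨d, hne, hsupp, hrow, hcol⟩ := exists_balanced_direction_of_not_isAcyclic b hcyc
    rcases le_total 0 (∑ i, ∑ j, w i * d i j * (Real.log (v i j) - Real.log (∑ i', b i' j)))
      with h | h
    · exact ⟨d, hne, hsupp, hrow, hcol, h⟩
    · exact ⟨fun i j => -d i j, by simpa using hne, by simpa using hsupp, by simpa using hrow,
        by simpa using hcol, by simpa using h⟩
  obtain ⟨t, ht, hnonneg, i₀, j₀, hpos, hzero⟩ :=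
    exists_add_mul_nonneg_of_sum_eq_zero b d hb.1 hne hsupp hrow
  refine ⟨fun i j => b i j + t * d i j, ⟨hnonneg, fun i => ?_, fun j => ?_⟩, fun i j hij => ?_,
    ⟨i₀, j₀, hpos.ne', hzero⟩, ?_⟩
  · rw [sum_add_distrib, ← mul_sum, hrow, hb.2.1, mul_zero, add_zero]
  · rw [sum_add_distrib, ← mul_sum, hcol, mul_zero, add_zero]
    exact hb.2.2 j
  · have : d i j = 0 := by
      by_contra h
      exact (hsupp i j h).ne' hij
    simp [hij, this]
  · rw [fncvx_add_mul v w b d t hcol]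
    exact le_add_of_nonneg_right (mul_nonneg ht hobj)

end AcyclicImprovement

/-- Lemma `forest`: For any feasible point `b̄ ∈ P(𝒜,𝒢)` there exists an
acyclic solution `b^forest ∈ P(𝒜,𝒢)` supported within the support of `b̄` with
`f_ncvx(b^forest) ≥ f_ncvx(b̄)`. -/
theorem exists_acyclic_ncvx_improvement
    (A G : Type*) [Fintype A] [Fintype G]
    (v : A → G → ℝ) (w : A → ℝ)
    (hv : ∀ i j, 0 ≤ v i j) (hw : ∀ i, 0 < w i) (hws : ∑ i, w i = 1)
    (bbar : A → G → ℝ) (hbbar : Feasible bbar) :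
    ∃ bforest : A → G → ℝ, Feasible bforest ∧
      (supportGraph bforest).IsAcyclic ∧
      (∀ i j, bbar i j = 0 → bforest i j = 0) ∧
      fncvx v w bforest ≥ fncvx v w bbar := by
  classical
  induction hn : #{p : A × G | bbar p.1 p.2 ≠ 0} using Nat.strong_induction_on
    generalizing bbar with
  | _ n ih =>
    by_cases hcyc : (supportGraph bbar).IsAcyclic
    · exact ⟨bbar, hbbar, hcyc, fun _ _ h => h, le_rfl⟩
    · obtain ⟨b', hb', hsupp, ⟨i₀, j₀, hne, hzero⟩, hobj⟩ :=
        exists_smaller_support_of_not_isAcyclic v w bbar hbbar hcyc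
      have hlt : #{p : A × G | b' p.1 p.2 ≠ 0} < n := by
        rw [← hn]
        refine card_lt_card ((ssubset_iff_of_subset fun p hp => ?_).2 ⟨(i₀, j₀), ?_, ?_⟩)
        · simp only [mem_filter, mem_univ, true_and] at hp ⊢
          exact fun h => hp (hsupp _ _ h)
        · simpa using hne
        · simpa using hzero
      obtain ⟨c, hc, hacyc, hcs, hcobj⟩ := ih _ hlt b' hb' rfl
      exact ⟨c, hc, hacyc, fun i j h => hcs i j (hsupp i j h), hobj.trans hcobj⟩
end

section
/- For every b ∈ P(𝒜,𝒢) and weights w_1, …, w_n > 0 with Σ_{i∈𝒜} w_i = 1, one has 0 ≤ f_cvx(b) − f_ncvx(b) ≤ D_KL(w‖u) = log n + Σ_{i∈𝒜} w_i log w_i. -/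
open Finset

theorem mul_log_sub_log_le {a x : ℝ} (ha : 0 ≤ a) (hx : 0 < x) :
    a * (Real.log x - Real.log a) ≤ x - a := by
  rcases ha.eq_or_lt with rfl | ha
  · simpa using hx.le
  · calc a * (Real.log x - Real.log a) = a * Real.log (x / a) := by
          rw [Real.log_div hx.ne' ha.ne']
      _ ≤ a * (x / a - 1) := by gcongr; exact Real.log_le_sub_one_of_pos (by positivity)
      _ = x - a := by field_simp

theorem fcvx_sub_fncvx_eq {A G : Type*} [Fintype A] [Fintype G]
    (v : A → G → ℝ) (w : A → ℝ) (b : A → G → ℝ) (hb : ∀ i, ∑ j, b i j = 1) :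
    fcvx v w b - fncvx v w b =
      ∑ j, ∑ i, w i * b i j *
        (Real.log (w i) + Real.log (∑ i', b i' j) - Real.log (∑ i', w i' * b i' j)) := by
  have h : ∑ i, w i * Real.log (w i) = ∑ j, ∑ i, w i * b i j * Real.log (w i) := by
    rw [sum_comm]
    refine sum_congr rfl fun i _ => ?_
    rw [← sum_mul, ← mul_sum, hb, mul_one]
  simp only [fcvx, fncvx, h, mul_sub, mul_add, sum_sub_distrib, sum_add_distrib, sum_mul]
  rw [sum_comm (f := fun i j => w i * b i j * Real.log (∑ i', b i' j))]
  ring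

/-- A weighted log-sum inequality, valid also when all the `b i` vanish. -/
theorem sum_mul_log_nonneg {A : Type*} [Fintype A] {w b : A → ℝ}
    (hw : ∀ i, 0 < w i) (hb : ∀ i, 0 ≤ b i) :
    0 ≤ ∑ i, w i * b i *
      (Real.log (w i) + Real.log (∑ i', b i') - Real.log (∑ i', w i' * b i')) := by
  by_cases h0 : ∀ i, b i = 0
  · simp [h0]
  push Not at h0
  obtain ⟨k, hk⟩ := h0
  have hbk : 0 < b k := (hb k).lt_of_ne' hk
  have hq : 0 < ∑ i, b i := sum_pos' (fun i _ => hb i) ⟨k, mem_univ k, hbk⟩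
  have ha : 0 < ∑ i, w i * b i := sum_pos' (fun i _ => mul_nonneg (hw i).le (hb i))
    ⟨k, mem_univ k, mul_pos (hw k) hbk⟩
  set q := ∑ i, b i with hqdef
  set a := ∑ i, w i * b i with hadef
  calc (0 : ℝ) = ∑ i, (w i * b i - b i * (a / q)) := by
        rw [sum_sub_distrib, ← sum_mul, ← hqdef, ← hadef]
        field_simp
        ring
    _ ≤ _ := sum_le_sum fun i _ => by
        have h := mul_le_mul_of_nonneg_left
          (mul_log_sub_log_le (hw i).le (div_pos ha hq)) (hb i)
        rw [Real.log_div ha.ne' hq.ne'] at h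
        linarith

theorem sum_mul_log_le {A : Type*} [Fintype A] {w b : A → ℝ} {n : ℝ} (hn : 0 < n)
    (hw : ∀ i, 0 < w i) (hb : ∀ i, 0 ≤ b i) :
    ∑ i, w i * b i *
        (Real.log (w i) + Real.log (∑ i', b i') - Real.log (∑ i', w i' * b i')) ≤
      ∑ i, w i * b i * (Real.log n + Real.log (w i)) + ∑ i, b i / n - ∑ i, w i * b i := by
  by_cases h0 : ∀ i, b i = 0
  · simp [h0]
  push Not at h0
  obtain ⟨k, hk⟩ := h0
  have hq : 0 < ∑ i, b i := sum_pos' (fun i _ => hb i)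
    ⟨k, mem_univ k, (hb k).lt_of_ne' hk⟩
  have h := mul_log_sub_log_le (sum_nonneg fun i (_ : i ∈ univ) => mul_nonneg (hw i).le (hb i))
    (div_pos hq hn)
  rw [Real.log_div hq.ne' hn.ne'] at h
  simp only [mul_sub, mul_add, sum_sub_distrib, sum_add_distrib, ← sum_mul, ← sum_div] at h ⊢
  linarith

/-- Lemma `diff`: For every `b ∈ P(𝒜,𝒢)` and weights `w_i > 0` summing to 1,
`0 ≤ f_cvx(b) − f_ncvx(b) ≤ D_KL(w‖u) = log n + Σ_i w_i log w_i`. -/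
theorem fcvx_sub_fncvx_bounds
    (A G : Type*) [Fintype A] [Fintype G]
    (v : A → G → ℝ) (w : A → ℝ)
    (hv : ∀ i j, 0 ≤ v i j) (hw : ∀ i, 0 < w i) (hws : ∑ i, w i = 1)
    (b : A → G → ℝ) (hb : Feasible b) :
    0 ≤ fcvx v w b - fncvx v w b ∧ fcvx v w b - fncvx v w b ≤ DKL w := by
  have hn : (0 : ℝ) < Fintype.card A := by
    rcases isEmpty_or_nonempty A with h | h
    · simp at hws
    · exact_mod_cast Fintype.card_pos
  obtain ⟨hb0, hb1, -⟩ := hb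
  rw [fcvx_sub_fncvx_eq v w b hb1]
  refine ⟨sum_nonneg fun j _ => sum_mul_log_nonneg hw fun i => hb0 i j,
    (sum_le_sum fun j _ => sum_mul_log_le hn hw fun i => hb0 i j).trans_eq ?_⟩
  have h1 (c : A → ℝ) : ∑ j, ∑ i, w i * b i j * c i = ∑ i, w i * c i := by
    rw [sum_comm]
    refine sum_congr rfl fun i _ => ?_
    rw [← sum_mul, ← mul_sum, hb1, mul_one]
  have h2 : ∑ j, ∑ i, w i * b i j = 1 := by simpa [hws] using h1 fun _ => 1
  have h3 : ∑ j, ∑ i, b i j / (Fintype.card A : ℝ) = 1 := by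
    rw [sum_comm]
    simp [← sum_div, hb1, hn.ne']
  rw [sum_sub_distrib, sum_add_distrib, h1, h2, h3, DKL]
  simp only [mul_add, sum_add_distrib, ← sum_mul, hws]
  ring
end

section
/- Let b̂ ∈ P(𝒜,𝒢) be an acyclic feasible point such that b̂_{ij} > 0 implies v_{ij} > 0, let b* maximize f_cvx over { b ∈ P(𝒜,𝒢) : b_{ij} = 0 whenever b̂_{ij} = 0 } (write q*_j = Σ_{i∈𝒜} b*_{ij}), and let F be the rooted forest obtained by rooting every connected component of G_supp(b*) at an agent node. Then there exists an acyclic feasible point b^pruned ∈ P(𝒜,𝒢) (write q^pruned_j = Σ_{i∈𝒜} b^pruned_{ij}) with b^pruned_{ij} = 0 whenever b*_{ij} = 0, such that: (1) q^pruned_j ≥ q*_j for every item j with q*_j ≥ 1/2; (2) every item j with q*_j < 1/2 is a leaf of G_supp(b^pruned) whose unique neighbor is its parent agent in F; and (3) f_cvx(b^pruned) ≥ f_cvx(b*) − log 2. -/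
open Finset

/-- `par : 𝒢 → 𝒜` is the parent function (restricted to item nodes) of the rooted forest
obtained by rooting every connected component of the acyclic support graph of `b` at an
agent node: every non-isolated item is adjacent to its parent, and every agent has at most
one adjacent item of which it is not the parent (namely its own parent item). -/
def IsParentFn {A G : Type*} [Fintype A] [Fintype G] (b : A → G → ℝ) (par : G → A) : Prop :=
  (∀ j, 0 < ∑ i, b i j → 0 < b (par j) j) ∧
  (∀ i j j', 0 < b i j → 0 < b i j' → par j ≠ i → par j' ≠ i → j = j')

/-- **Knaster–Tarski** on a cube of real numbers. -/
lemma exists_fixedPoint_of_monotone_cube {A : Type*} {lo hi : ℝ} (h : lo ≤ hi)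
    (Φ : (A → ℝ) → A → ℝ)
    (hmono : ∀ s t : A → ℝ, (∀ i, s i ∈ Set.Icc lo hi) → (∀ i, t i ∈ Set.Icc lo hi) →
      s ≤ t → Φ s ≤ Φ t)
    (hmaps : ∀ s : A → ℝ, (∀ i, s i ∈ Set.Icc lo hi) → ∀ i, Φ s i ∈ Set.Icc lo hi) :
    ∃ s : A → ℝ, (∀ i, s i ∈ Set.Icc lo hi) ∧ Φ s = s := by
  have : Fact (lo ≤ hi) := ⟨h⟩
  let F : (A → Set.Icc lo hi) →o (A → Set.Icc lo hi) :=
    { toFun := fun s i => ⟨Φ (fun k => (s k : ℝ)) i, hmaps _ (fun k => (s k).2) i⟩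
      monotone' := fun s t hst i =>
        hmono _ _ (fun k => (s k).2) (fun k => (t k).2) (fun k => hst k) i }
  have hF := F.map_lfp
  refine ⟨fun i => (F.lfp i : ℝ), fun i => (F.lfp i).2, ?_⟩
  funext i
  exact congrArg Subtype.val (congrFun hF i)

/-- A property holding at `0` and at all terms holds for a sum with at most one nonzero term. -/
lemma sum_induction_of_subsingleton_support {G : Type*} [Fintype G] (P : ℝ → Prop) (f : G → ℝ)
    (h0 : P 0) (hf : ∀ j, P (f j)) (hone : ∀ j j', f j ≠ 0 → f j' ≠ 0 → j = j') :
    P (∑ j, f j) := by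
  by_cases h : ∃ j, f j ≠ 0
  · obtain ⟨j, hj⟩ := h
    rw [Finset.sum_eq_single j]
    · exact hf j
    · intro k _ hk
      by_contra hk'
      exact hk (hone k j hk' hj)
    · simp
  · push Not at h
    simpa [h] using h0

/-- The factor by which the shares of the non-parent agents of an item shrink, when the item has
total share `q`, its parent agent holds `B`, and the share of the parent is multiplied by `s`. -/
noncomputable def childFactor (q B s : ℝ) : ℝ :=
  if q < 1 / 2 then 0 else max 0 (min 1 ((1 - s * B) / (q - B)))

lemma childFactor_nonneg (q B s : ℝ) : 0 ≤ childFactor q B s := by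
  unfold childFactor; split_ifs <;> simp

lemma childFactor_le_one (q B s : ℝ) : childFactor q B s ≤ 1 := by
  unfold childFactor; split_ifs <;> simp

lemma childFactor_anti {q B s t : ℝ} (hB : 0 ≤ B) (hq : B ≤ q) (hst : s ≤ t) :
    childFactor q B t ≤ childFactor q B s := by
  unfold childFactor
  split_ifs
  · exact le_rfl
  · have : 0 ≤ q - B := sub_nonneg.2 hq
    gcongr

lemma two_sub_childFactor_mul_le {q B s x : ℝ} (hB : 0 ≤ B) (hx : 0 ≤ x) (hxq : x + B ≤ q)
    (hq : q ≤ 1) (hs : s ≤ 2) : (2 - childFactor q B s) * x ≤ 1 := by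
  have h0 := childFactor_nonneg q B s
  by_cases hl : x ≤ 1 / 2
  · nlinarith
  have hnl : ¬ q < 1 / 2 := by linarith
  have hu : min 1 ((1 - s * B) / (q - B)) ≤ childFactor q B s := by
    rw [childFactor, if_neg hnl]
    exact le_max_right _ _
  have hpos : 0 < q - B := by linarith
  rcases min_le_iff.1 hu with h | h
  · nlinarith
  · rw [div_le_iff₀ hpos] at h
    have h1 := childFactor_le_one q B s
    nlinarith

/-- The total share of an item after scaling. -/
lemma childFactor_total {q B s : ℝ} (hBq : B ≤ q) (hs : 1 ≤ s) (hB : 0 ≤ B) (hsB : s * B ≤ 1) :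
    s * B + childFactor q B s * (q - B) ≤ 1 ∧
      (1 / 2 ≤ q → q ≤ 1 → q ≤ s * B + childFactor q B s * (q - B)) := by
  have hBs : B ≤ s * B := le_mul_of_one_le_left hB hs
  unfold childFactor
  split_ifs with hl
  · exact ⟨by linarith, fun h => by linarith⟩
  · rcases hBq.eq_or_lt with rfl | hlt
    · simp [hsB, hBs]
    · have hpos : 0 < q - B := sub_pos.2 hlt
      have hd : 0 ≤ (1 - s * B) / (q - B) := div_nonneg (by linarith) hpos.le
      rw [max_eq_right (le_min zero_le_one hd)]
      rcases le_total 1 ((1 - s * B) / (q - B)) with h | h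
      · rw [min_eq_left h]
        rw [le_div_iff₀ hpos] at h
        exact ⟨by linarith, fun _ _ => by linarith⟩
      · rw [min_eq_right h, div_mul_cancel₀ _ hpos.ne']
        exact ⟨by linarith, fun _ _ => by linarith⟩

open Classical in
/-- There are scaling factors in `[1, 2]`, one per agent, for the edges to its child items, which
together with the induced `childFactor`s on the remaining edges preserve all row sums. -/
lemma exists_scaling {A G : Type*} [Fintype A] [Fintype G] {b : A → G → ℝ} (hb : Feasible b)
    {par : G → A} (hpar : IsParentFn b par) :
    ∃ s : A → ℝ, (∀ i, s i ∈ Set.Icc (1 : ℝ) 2) ∧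
      ∀ i, ∑ j, (if par j = i then s i else
        childFactor (∑ k, b k j) (b (par j) j) (s (par j))) * b i j = 1 := by
  obtain ⟨hb0, hbrow, hbcol⟩ := hb
  obtain ⟨hp1, hp2⟩ := hpar
  set u : (A → ℝ) → G → ℝ := fun s j =>
    childFactor (∑ k, b k j) (b (par j) j) (s (par j)) with hu
  set R : A → ℝ := fun i => ∑ j, if par j = i then b i j else 0 with hR
  set Q : (A → ℝ) → A → ℝ := fun s i => ∑ j, if par j = i then 0 else u s j * b i j with hQ
  have hcomp : ∀ i, R i + ∑ j, (if par j = i then 0 else b i j) = 1 := by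
    intro i
    rw [hR, ← Finset.sum_add_distrib, ← hbrow i]
    refine Finset.sum_congr rfl fun j _ => ?_
    split_ifs <;> simp
  have hle : ∀ i j, par j ≠ i → b i j + b (par j) j ≤ ∑ k, b k j := by
    intro i j h
    rw [← Finset.sum_pair (f := fun k => b k j) h.symm]
    exact Finset.sum_le_sum_of_subset_of_nonneg (Finset.subset_univ _) fun k _ _ => hb0 k j
  have hsingle : ∀ i (c : G → ℝ) (j j' : G), (if par j = i then 0 else c j * b i j) ≠ 0 →
      (if par j' = i then 0 else c j' * b i j') ≠ 0 → j = j' := by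
    intro i c j j' h h'
    by_cases hj : par j = i
    · simp [hj] at h
    by_cases hj' : par j' = i
    · simp [hj'] at h'
    simp only [hj, hj', if_false] at h h'
    exact hp2 i j j' ((hb0 i j).lt_of_ne' (right_ne_zero_of_mul h))
      ((hb0 i j').lt_of_ne' (right_ne_zero_of_mul h')) hj hj'
  have hRpos : ∀ i, 0 < R i := by
    intro i
    have : ∑ j, (if par j = i then 0 else (1 : ℝ) * b i j) < 1 := by
      refine sum_induction_of_subsingleton_support (· < 1) _ zero_lt_one (fun j => ?_)
        (hsingle i fun _ => 1)
      split_ifs with h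
      · exact zero_lt_one
      · rcases (hb0 i j).eq_or_lt with h0 | h0
        · simp [← h0]
        · have hq : 0 < ∑ k, b k j :=
            h0.trans_le (Finset.single_le_sum (fun k _ => hb0 k j) (Finset.mem_univ i))
          linarith [hp1 j hq, hle i j h, hbcol j]
    simp only [one_mul] at this
    linarith [hcomp i]
  have hlow : ∀ s i, R i ≤ 1 - Q s i := by
    intro s i
    have : Q s i ≤ ∑ j, (if par j = i then 0 else b i j) := by
      refine Finset.sum_le_sum fun j _ => ?_
      split_ifs
      · exact le_rfl
      · exact mul_le_of_le_one_left (hb0 i j) (childFactor_le_one _ _ _)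
    linarith [hcomp i]
  have hupp : ∀ s : A → ℝ, (∀ i, s i ∈ Set.Icc (1 : ℝ) 2) → ∀ i, 1 - Q s i ≤ 2 * R i := by
    intro s hs i
    have h1 : ∑ j, (if par j = i then 0 else (2 - u s j) * b i j) ≤ 1 := by
      refine sum_induction_of_subsingleton_support (· ≤ 1) _ zero_le_one (fun j => ?_)
        (hsingle i fun j => 2 - u s j)
      split_ifs with h
      · exact zero_le_one
      · exact two_sub_childFactor_mul_le (hb0 _ _) (hb0 _ _) (hle i j h) (hbcol j) (hs _).2
    have h2 : ∑ j, (if par j = i then 0 else (2 - u s j) * b i j) =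
        2 * ∑ j, (if par j = i then 0 else b i j) - Q s i := by
      rw [hQ, Finset.mul_sum, ← Finset.sum_sub_distrib]
      refine Finset.sum_congr rfl fun j _ => ?_
      split_ifs <;> ring
    linarith [hcomp i]
  obtain ⟨s, hs, hfix⟩ := exists_fixedPoint_of_monotone_cube (lo := 1) (hi := 2) one_le_two
    (fun s i => (1 - Q s i) / R i)
    (by
      intro s t _ _ hst i
      have hR0 := (hRpos i).le
      have hQle : Q t i ≤ Q s i := by
        refine Finset.sum_le_sum fun j _ => ?_
        split_ifs
        · exact le_rfl
        · exact mul_le_mul_of_nonneg_right (childFactor_anti (hb0 _ _)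
            (Finset.single_le_sum (f := fun k => b k j) (fun k _ => hb0 k j)
              (Finset.mem_univ _)) (hst _)) (hb0 i j)
      dsimp only
      gcongr)
    (fun s hs i => ⟨by rw [le_div_iff₀ (hRpos i)]; linarith [hlow s i],
      by rw [div_le_iff₀ (hRpos i)]; exact hupp s hs i⟩)
  refine ⟨s, hs, fun i => ?_⟩
  have hi : (1 - Q s i) / R i = s i := congrFun hfix i
  rw [div_eq_iff (hRpos i).ne'] at hi
  have : ∑ j, (if par j = i then s i else u s j) * b i j = s i * R i + Q s i := by
    rw [hR, hQ, Finset.mul_sum, ← Finset.sum_add_distrib]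
    refine Finset.sum_congr rfl fun j _ => ?_
    split_ifs <;> simp
  change ∑ j, (if par j = i then s i else u s j) * b i j = 1
  linarith

/-- The pruned solution: the combinatorial part of the pruning lemma, with the pointwise
bound `bp ≤ 2 b`. -/
lemma exists_pruned {A G : Type*} [Fintype A] [Fintype G] {b : A → G → ℝ} (hb : Feasible b)
    {par : G → A} (hpar : IsParentFn b par) :
    ∃ bp : A → G → ℝ, Feasible bp ∧ (∀ i j, bp i j ≤ 2 * b i j) ∧
      (∀ j, 1 / 2 ≤ ∑ i, b i j → (∑ i, b i j) ≤ ∑ i, bp i j) ∧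
      (∀ j, (∑ i, b i j) < 1 / 2 →
        (0 < ∑ i, b i j → 0 < bp (par j) j) ∧ (∀ i, 0 < bp i j → i = par j)) := by
  classical
  obtain ⟨s, hs, hrow⟩ := exists_scaling hb hpar
  obtain ⟨hb0, hbrow, hbcol⟩ := hb
  set u : G → ℝ := fun j => childFactor (∑ k, b k j) (b (par j) j) (s (par j)) with hu
  set bp : A → G → ℝ := fun i j => (if par j = i then s i else u j) * b i j with hbp
  have hbp0 : ∀ i j, 0 ≤ bp i j := by
    intro i j
    refine mul_nonneg ?_ (hb0 i j)
    split_ifs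
    · linarith [(hs i).1]
    · exact childFactor_nonneg _ _ _
  have hbppar : ∀ j, bp (par j) j = s (par j) * b (par j) j := by
    intro j; simp [hbp]
  have hcol : ∀ j, ∑ i, bp i j =
      s (par j) * b (par j) j + u j * (∑ k, b k j - b (par j) j) := by
    intro j
    rw [← Finset.add_sum_erase _ _ (Finset.mem_univ (par j)), hbppar,
      ← Finset.add_sum_erase _ (fun k => b k j) (Finset.mem_univ (par j)), add_sub_cancel_left,
      Finset.mul_sum]
    congr 1
    refine Finset.sum_congr rfl fun i hi => ?_
    simp [hbp, (Finset.ne_of_mem_erase hi).symm]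
  have htot := fun j => childFactor_total (q := ∑ k, b k j) (B := b (par j) j) (s := s (par j))
    (Finset.single_le_sum (f := fun k => b k j) (fun k _ => hb0 k j) (Finset.mem_univ _))
    (hs _).1 (hb0 _ _) (by
      rw [← hbppar, ← hrow (par j)]
      exact Finset.single_le_sum (f := fun l => bp (par j) l) (fun l _ => hbp0 _ l)
        (Finset.mem_univ j))
  refine ⟨bp, ⟨hbp0, hrow, fun j => (hcol j).trans_le (htot j).1⟩, ?_, ?_, ?_⟩
  · intro i j
    refine mul_le_mul_of_nonneg_right ?_ (hb0 i j)
    split_ifs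
    · exact (hs i).2
    · exact (childFactor_le_one _ _ _).trans one_le_two
  · intro j hj
    rw [hcol j]
    exact (htot j).2 hj (hbcol j)
  · intro j hj
    refine ⟨fun hq => ?_, fun i hi => ?_⟩
    · rw [hbppar]
      exact mul_pos (by linarith [(hs (par j)).1]) (hpar.1 j hq)
    · by_contra hne
      have : u j = 0 := by simp only [hu, childFactor, if_pos hj]
      simp [hbp, this, Ne.symm hne] at hi

/-- The value of `fcvx` relative to a reference point: a linear part and a relative entropy. -/
lemma fcvx_sub_fcvx {A G : Type*} [Fintype A] [Fintype G]
    (v : A → G → ℝ) (w : A → ℝ) (b c : A → G → ℝ) :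
    fcvx v w c - fcvx v w b =
      ∑ i, ∑ j, w i * (c i j - b i j) * (Real.log (v i j) - Real.log (∑ k, w k * b k j)) -
      ∑ j, (∑ i, w i * c i j) *
        (Real.log (∑ i, w i * c i j) - Real.log (∑ i, w i * b i j)) := by
  have h : ∀ e : A → G → ℝ, ∑ i, ∑ j, w i * e i j * Real.log (∑ k, w k * b k j) =
      ∑ j, (∑ i, w i * e i j) * Real.log (∑ i, w i * b i j) := by
    intro e
    rw [Finset.sum_comm]
    exact Finset.sum_congr rfl fun j _ => (Finset.sum_mul _ _ _).symm
  simp only [fcvx, mul_sub, sub_mul, Finset.sum_sub_distrib, h]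
  ring

/-- A `χ²`-type upper bound for the terms of a relative entropy. -/
lemma mul_log_sub_log_le_s11 {p r : ℝ} (hp : 0 ≤ p) (hr : 0 ≤ r) (h : r = 0 → p = 0) :
    p * (Real.log p - Real.log r) ≤ (p - r) + (p - r) ^ 2 / r := by
  rcases hr.eq_or_lt with h0 | h0
  · simp [h h0.symm, ← h0]
  rcases hp.eq_or_lt with hp0 | hp0
  · rw [← hp0]
    have : (0 - r) ^ 2 / r = r := by field_simp; ring
    rw [this]; simp
  · rw [← Real.log_div hp0.ne' h0.ne']
    calc p * Real.log (p / r) ≤ p * (p / r - 1) :=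
          mul_le_mul_of_nonneg_left (Real.log_le_sub_one_of_pos (div_pos hp0 h0)) hp
      _ = (p - r) + (p - r) ^ 2 / r := by field_simp; ring

lemma mul_log_sub_log_le_mul_log_two {p r : ℝ} (hp : 0 ≤ p) (h : p ≤ 2 * r) :
    p * (Real.log p - Real.log r) ≤ p * Real.log 2 := by
  rcases hp.eq_or_lt with hp0 | hp0
  · simp [← hp0]
  · have hr : 0 < r := by linarith
    refine mul_le_mul_of_nonneg_left ?_ hp
    rw [sub_le_iff_le_add, ← Real.log_mul two_ne_zero hr.ne']
    exact Real.log_le_log hp0 h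

lemma nonneg_of_forall_mul_le_sq {D C : ℝ}
    (h : ∀ ε : ℝ, 0 < ε → ε ≤ 1 → -(ε * D) ≤ ε ^ 2 * C) : 0 ≤ D := by
  by_contra! hD
  have hC : 0 < C := by have := h 1 one_pos le_rfl; linarith
  have hε : 0 < min 1 (-D / (2 * C)) := lt_min one_pos (by apply div_pos <;> linarith)
  have h1 := h _ hε (min_le_left _ _)
  have h2 : min 1 (-D / (2 * C)) * (2 * C) ≤ -D := by
    rw [← le_div_iff₀ (by linarith)]; exact min_le_right _ _
  nlinarith

/-- Sum over all items of the weighted shares of a feasible point. -/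
lemma Feasible.sum_weighted {A G : Type*} [Fintype A] [Fintype G] {b : A → G → ℝ}
    (hb : Feasible b) (w : A → ℝ) : ∑ j, ∑ i, w i * b i j = ∑ i, w i := by
  rw [Finset.sum_comm]
  refine Finset.sum_congr rfl fun i _ => ?_
  rw [← Finset.mul_sum, hb.2.1 i, mul_one]

lemma supportGraph_mono {A G : Type*} {b c : A → G → ℝ} (h : ∀ i j, 0 < b i j → 0 < c i j) :
    supportGraph b ≤ supportGraph c := by
  intro x y hxy
  simp only [supportGraph, SimpleGraph.fromRel_adj] at hxy ⊢
  refine ⟨hxy.1, hxy.2.imp ?_ ?_⟩ <;>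
  · rintro ⟨i, j, hx, hy, hij⟩
    exact ⟨i, j, hx, hy, h i j hij⟩

/-- Extrapolating backwards from `b` away from `c` stays feasible. -/
lemma Feasible.extrapolate {A G : Type*} [Fintype A] [Fintype G] {b c : A → G → ℝ}
    (hb : Feasible b) (hc : Feasible c) (hle : ∀ i j, c i j ≤ 2 * b i j)
    (hq : ∀ j, 1 / 2 ≤ ∑ i, b i j → (∑ i, b i j) ≤ ∑ i, c i j)
    {ε : ℝ} (hε : 0 ≤ ε) (hε1 : ε ≤ 1) :
    Feasible fun i j => b i j + ε * (b i j - c i j) := by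
  refine ⟨fun i j => ?_, fun i => ?_, fun j => ?_⟩
  · nlinarith [hle i j, hb.1 i j]
  · rw [Finset.sum_add_distrib, ← Finset.mul_sum, Finset.sum_sub_distrib, hb.2.1, hc.2.1]
    ring
  · rw [Finset.sum_add_distrib, ← Finset.mul_sum, Finset.sum_sub_distrib]
    have h0 : 0 ≤ ∑ i, c i j := Finset.sum_nonneg fun i _ => hc.1 i j
    have h0' : 0 ≤ ∑ i, b i j := Finset.sum_nonneg fun i _ => hb.1 i j
    rcases le_or_gt (1 / 2) (∑ i, b i j) with h | h
    · nlinarith [hq j h, hb.2.2 j]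
    · nlinarith

/-- Lemma `after-pruning`: Let `b*` maximize `f_cvx` over the feasible points
supported within the support of an acyclic feasible point `b̂` (whose support lies in the
support of `v`), and let `F` (given by the parent function `par`) be the rooted forest obtained
by rooting every connected component of `G_supp(b*)` at an agent node.  Then there exists an
acyclic feasible `b^pruned` supported within the support of `b*` such that:
(1) `q^pruned_j ≥ q*_j` for every item `j` with `q*_j ≥ 1/2`;
(2) every item `j` with `q*_j < 1/2` is a leaf of `G_supp(b^pruned)` whose unique neighbor is
    its parent agent in `F`; and
(3) `f_cvx(b^pruned) ≥ f_cvx(b*) − log 2`. -/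
theorem pruning_lemma
    (A G : Type*) [Fintype A] [Fintype G]
    (v : A → G → ℝ) (w : A → ℝ)
    (hv : ∀ i j, 0 ≤ v i j) (hw : ∀ i, 0 < w i) (hws : ∑ i, w i = 1)
    (bhat bstar : A → G → ℝ)
    (hbhat : Feasible bhat)
    (hbhatacyc : (supportGraph bhat).IsAcyclic)
    (hbhatv : ∀ i j, 0 < bhat i j → 0 < v i j)
    (hbstar : Feasible bstar)
    (hbstarsupp : ∀ i j, bhat i j = 0 → bstar i j = 0)
    (hopt : ∀ b' : A → G → ℝ, Feasible b' → (∀ i j, bhat i j = 0 → b' i j = 0) →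
      fcvx v w b' ≤ fcvx v w bstar)
    (par : G → A) (hpar : IsParentFn bstar par) :
    ∃ bp : A → G → ℝ, Feasible bp ∧
      (supportGraph bp).IsAcyclic ∧
      (∀ i j, bstar i j = 0 → bp i j = 0) ∧
      (∀ j, 1 / 2 ≤ ∑ i, bstar i j → (∑ i, bstar i j) ≤ ∑ i, bp i j) ∧
      (∀ j, (∑ i, bstar i j) < 1 / 2 →
        (0 < ∑ i, bstar i j → 0 < bp (par j) j) ∧ (∀ i, 0 < bp i j → i = par j)) ∧
      fcvx v w bp ≥ fcvx v w bstar - Real.log 2 := by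
  obtain ⟨bp, hbp, hle, hheavy, hlight⟩ := exists_pruned hbstar hpar
  have hzero : ∀ i j, bstar i j = 0 → bp i j = 0 := fun i j h =>
    le_antisymm (by simpa [h] using hle i j) (hbp.1 i j)
  have hhatpos : ∀ i j, 0 < bp i j → 0 < bhat i j := fun i j h =>
    (hbhat.1 i j).lt_of_ne' fun h0 => h.ne' (hzero i j (hbstarsupp i j h0))
  refine ⟨bp, hbp, hbhatacyc.anti (supportGraph_mono hhatpos), hzero, hheavy, hlight, ?_⟩
  set r : G → ℝ := fun j => ∑ i, w i * bstar i j with hr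
  set p : G → ℝ := fun j => ∑ i, w i * bp i j with hp
  have hr0 : ∀ j, 0 ≤ r j := fun j =>
    Finset.sum_nonneg fun i _ => mul_nonneg (hw i).le (hbstar.1 i j)
  have hp0 : ∀ j, 0 ≤ p j := fun j =>
    Finset.sum_nonneg fun i _ => mul_nonneg (hw i).le (hbp.1 i j)
  have hpr : ∀ j, p j ≤ 2 * r j := by
    intro j
    rw [hp, hr, Finset.mul_sum]
    refine Finset.sum_le_sum fun i _ => ?_
    nlinarith [hle i j, hw i]
  have hp1 : ∑ j, p j = 1 := (hbp.sum_weighted w).trans hws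
  have hr1 : ∑ j, r j = 1 := (hbstar.sum_weighted w).trans hws
  set D : ℝ := ∑ i, ∑ j, w i * (bp i j - bstar i j) * (Real.log (v i j) - Real.log (r j)) with hD
  have hD0 : 0 ≤ D := by
    refine nonneg_of_forall_mul_le_sq (C := ∑ j, (r j - p j) ^ 2 / r j) fun ε hε hε1 => ?_
    set c : A → G → ℝ := fun i j => bstar i j + ε * (bstar i j - bp i j) with hc
    have hcf : Feasible c := hbstar.extrapolate hbp hle hheavy hε.le hε1
    have hopt' := hopt c hcf fun i j h => by
      simp [hc, hbstarsupp i j h, hzero i j (hbstarsupp i j h)]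
    have hcp : ∀ j, ∑ i, w i * c i j = r j + ε * (r j - p j) := by
      intro j
      rw [hr, hp, ← Finset.sum_sub_distrib, Finset.mul_sum, ← Finset.sum_add_distrib]
      exact Finset.sum_congr rfl fun i _ => by rw [hc]; ring
    have hlin : ∑ i, ∑ j, w i * (c i j - bstar i j) * (Real.log (v i j) - Real.log (r j)) =
        -(ε * D) := by
      rw [hD, ← neg_mul, Finset.mul_sum]
      refine Finset.sum_congr rfl fun i _ => ?_
      rw [Finset.mul_sum]
      exact Finset.sum_congr rfl fun j _ => by rw [hc]; ring
    have hkl : ∑ j, (∑ i, w i * c i j) * (Real.log (∑ i, w i * c i j) - Real.log (r j)) ≤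
        ε ^ 2 * ∑ j, (r j - p j) ^ 2 / r j := by
      have hsum : ∑ j, (ε * (r j - p j) + ε ^ 2 * ((r j - p j) ^ 2 / r j)) =
          ε ^ 2 * ∑ j, (r j - p j) ^ 2 / r j := by
        rw [Finset.sum_add_distrib, ← Finset.mul_sum, ← Finset.mul_sum, Finset.sum_sub_distrib,
          hr1, hp1]
        ring
      rw [← hsum]
      refine Finset.sum_le_sum fun j _ => ?_
      rw [hcp]
      have hnn : 0 ≤ r j + ε * (r j - p j) := by nlinarith [hpr j, hr0 j]
      refine (mul_log_sub_log_le_s11 hnn (hr0 j) fun h => ?_).trans_eq (by ring)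
      have : p j = 0 := le_antisymm (by simpa [h] using hpr j) (hp0 j)
      simp [h, this]
    have := fcvx_sub_fcvx v w bstar c
    rw [hlin] at this
    linarith
  have hkl : ∑ j, p j * (Real.log (p j) - Real.log (r j)) ≤ Real.log 2 := by
    calc ∑ j, p j * (Real.log (p j) - Real.log (r j)) ≤ ∑ j, p j * Real.log 2 :=
          Finset.sum_le_sum fun j _ => mul_log_sub_log_le_mul_log_two (hp0 j) (hpr j)
      _ = Real.log 2 := by rw [← Finset.sum_mul, hp1, one_mul]
  have := fcvx_sub_fcvx v w bstar bp
  linarith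
end

section
/- Let (b*, q*) be an acyclic feasible point in P(𝒜,𝒢) and let F be the rooted forest obtained by rooting every connected component of G_supp(b*) at an agent node. Then there exists a feasible point b^pruned ∈ P(𝒜,𝒢) (write q^pruned_j = Σ_{i∈𝒜} b^pruned_{ij}) with b^pruned_{ij} = 0 whenever b*_{ij} = 0, such that: (1) q^pruned_j ≥ q*_j for every item j with q*_j ≥ 1/2; (2) every item j with q*_j < 1/2 is a leaf of G_supp(b^pruned) whose unique neighbor is its parent agent in F; and (3) b^pruned_{ij} ≤ min{1, 2·b*_{ij}} for every pair (i,j) ∈ 𝒜 × 𝒢. -/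
open Finset

/-- The factor by which the edges from item `j` to its child agents are scaled, when the edge
from `j` to its parent agent is scaled by `f (par j)`. -/
noncomputable def childScale {A G : Type*} [Fintype A] (b : A → G → ℝ) (par : G → A)
    (f : A → ℝ) (j : G) : ℝ :=
  if ∑ i, b i j < 1 / 2 then 0
  else max 0 (∑ i, b i j - f (par j) * b (par j) j) / (∑ i, b i j - b (par j) j)

section
variable {A G : Type*} [Fintype A] {b : A → G → ℝ} {par : G → A}

lemma parent_le_colSum (hb : ∀ i j, 0 ≤ b i j) (j : G) : b (par j) j ≤ ∑ i, b i j :=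
  Finset.single_le_sum (f := fun i => b i j) (fun i _ => hb i j) (Finset.mem_univ _)

lemma add_parent_le_colSum (hb : ∀ i j, 0 ≤ b i j) {i : A} {j : G} (h : par j ≠ i) :
    b i j + b (par j) j ≤ ∑ i, b i j := by
  classical
  rw [← Finset.sum_pair (f := fun i => b i j) h.symm]
  exact Finset.sum_le_sum_of_subset_of_nonneg (Finset.subset_univ _) (fun i _ _ => hb i j)

lemma childScale_nonneg (hb : ∀ i j, 0 ≤ b i j) (f : A → ℝ) (j : G) :
    0 ≤ childScale b par f j := by
  have := parent_le_colSum (par := par) hb j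
  unfold childScale
  split_ifs
  · exact le_rfl
  · exact div_nonneg (le_max_left _ _) (by linarith)

lemma childScale_antitone (hb : ∀ i j, 0 ≤ b i j) {f g : A → ℝ} (hfg : f ≤ g) (j : G) :
    childScale b par g j ≤ childScale b par f j := by
  have := parent_le_colSum (par := par) hb j
  unfold childScale
  split_ifs
  · exact le_rfl
  · apply div_le_div_of_nonneg_right _ (by linarith)
    exact max_le_max le_rfl (sub_le_sub_left (mul_le_mul_of_nonneg_right (hfg _) (hb _ _)) _)

lemma childScale_le_one (hb : ∀ i j, 0 ≤ b i j) {f : A → ℝ} (hf : ∀ i, 1 ≤ f i) (j : G) :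
    childScale b par f j ≤ 1 := by
  have := parent_le_colSum (par := par) hb j
  unfold childScale
  split_ifs
  · exact zero_le_one
  · apply div_le_one_of_le₀ _ (by linarith)
    exact max_le (by linarith) (by nlinarith [hb (par j) j, hf (par j)])

lemma childScale_mul_of_half_le (hb : ∀ i j, 0 ≤ b i j) {f : A → ℝ} (hf : ∀ i, 1 ≤ f i) {j : G}
    (hj : 1 / 2 ≤ ∑ i, b i j) :
    childScale b par f j * (∑ i, b i j - b (par j) j) =
      max 0 (∑ i, b i j - f (par j) * b (par j) j) := by
  rw [childScale, if_neg hj.not_gt]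
  rcases eq_or_ne (∑ i, b i j - b (par j) j) 0 with h | h
  · have := le_mul_of_one_le_left (hb (par j) j) (hf (par j))
    rw [h, mul_zero, max_eq_left (by linarith)]
  · exact div_mul_cancel₀ _ h

/-- A child agent loses at most what it has left over at its other items. -/
lemma child_loss_le (hb : ∀ i j, 0 ≤ b i j) (hcol : ∀ j, ∑ i, b i j ≤ 1) {f : A → ℝ}
    (hf : ∀ i, 1 ≤ f i) (hf2 : ∀ i, f i ≤ 2) {i : A} {j : G} (h : par j ≠ i) :
    b i j - childScale b par f j * b i j ≤ 1 - b i j := by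
  have h1 := add_parent_le_colSum (par := par) hb h
  have h2 := hcol j
  rcases lt_or_ge (∑ i, b i j) (1 / 2) with hj | hj
  · rw [childScale, if_pos hj]
    linarith [hb (par j) j]
  · have h3 := childScale_mul_of_half_le (par := par) hb hf hj
    have h4 := childScale_le_one (par := par) hb hf j
    have h5 := le_max_right 0 (∑ i, b i j - f (par j) * b (par j) j)
    have h6 : (1 - childScale b par f j) * b i j ≤
        (1 - childScale b par f j) * (∑ i, b i j - b (par j) j) :=
      mul_le_mul_of_nonneg_left (by linarith) (by linarith)
    nlinarith [hb (par j) j, hf2 (par j)]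

lemma sum_parent_child [DecidableEq A] (u t : ℝ) (j : G) :
    ∑ i, (if par j = i then u * b i j else t * b i j) =
      u * b (par j) j + t * (∑ i, b i j - b (par j) j) := by
  have : ∀ i, (if par j = i then u * b i j else t * b i j) =
      (if par j = i then (u - t) * b i j else 0) + t * b i j := by
    intro i; split_ifs <;> ring
  simp only [this, Finset.sum_add_distrib, Finset.sum_ite_eq, Finset.mem_univ, if_true,
    ← Finset.mul_sum]
  ring

end

section
variable {A G : Type*} [Fintype A] [Fintype G] {b : A → G → ℝ} {par : G → A}

/-- An agent has positive value at the items it is the parent of, and this value bounds the loss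
at its parent item. -/
lemma child_items_bounds [DecidableEq A] (hb : Feasible b) (hpar : IsParentFn b par) (i : A) :
    0 < ∑ j, (if par j = i then b i j else 0) ∧
    ∀ s : G → ℝ, (∀ j, par j ≠ i → b i j - s j * b i j ≤ 1 - b i j) →
      1 - ∑ j, (if par j = i then 0 else s j * b i j) ≤
        2 * ∑ j, (if par j = i then b i j else 0) := by
  obtain ⟨h0, hrow, hcol⟩ := hb
  have hsplit : ∑ j, (if par j = i then b i j else 0) +
      ∑ j, (if par j = i then 0 else b i j) = 1 := by
    rw [← hrow i, ← Finset.sum_add_distrib]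
    exact Finset.sum_congr rfl fun j _ => by split_ifs <;> simp
  by_cases h : ∃ j, par j ≠ i ∧ 0 < b i j
  · obtain ⟨j, hj, hbj⟩ := h
    have key : ∀ s : G → ℝ, ∑ k, (if par k = i then 0 else s k * b i k) = s j * b i j := by
      intro s
      rw [Finset.sum_eq_single j, if_neg hj]
      · intro k _ hk
        split_ifs with hki
        · rfl
        · have : b i k = 0 := by
            by_contra hne
            exact hk (hpar.2 i k j (lt_of_le_of_ne (h0 i k) (Ne.symm hne)) hbj hki hj)
          rw [this, mul_zero]
      · simp
    have k1 := key (fun _ => 1)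
    simp only [one_mul] at k1
    rw [k1] at hsplit
    have h1 := add_parent_le_colSum (par := par) h0 hj
    have h2 : 0 < b (par j) j := hpar.1 j (by linarith [h0 (par j) j])
    refine ⟨by linarith [hcol j], fun s hs => ?_⟩
    rw [key s]
    linarith [hs j hj]
  · push Not at h
    have hz : ∀ j, par j ≠ i → b i j = 0 := fun j hj => le_antisymm (h j hj) (h0 i j)
    have key : ∀ s : G → ℝ, ∑ k, (if par k = i then 0 else s k * b i k) = 0 := by
      intro s
      refine Finset.sum_eq_zero fun k _ => ?_
      split_ifs with hk
      · rfl
      · rw [hz k hk, mul_zero]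
    have k1 := key (fun _ => 1)
    simp only [one_mul] at k1
    rw [k1] at hsplit
    refine ⟨by linarith, fun s _ => ?_⟩
    rw [key s]
    linarith

/-- The scaling factors of the agents, as a fixed point of a monotone operator on
`A → [1, 2]`. -/
lemma exists_agent_scale [DecidableEq A] (hb : Feasible b) (hpar : IsParentFn b par) :
    ∃ f : A → ℝ, (∀ i, 1 ≤ f i) ∧ (∀ i, f i ≤ 2) ∧ ∀ i,
      f i * ∑ j, (if par j = i then b i j else 0) +
        ∑ j, (if par j = i then 0 else childScale b par f j * b i j) = 1 := by
  have h0 := hb.1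
  have : Fact ((1 : ℝ) ≤ 2) := ⟨one_le_two⟩
  have hval : ∀ f : A → Set.Icc (1 : ℝ) 2, ∀ i,
      (1 - ∑ j, (if par j = i then 0 else childScale b par (fun i => (f i : ℝ)) j * b i j)) /
        ∑ j, (if par j = i then b i j else 0) ∈ Set.Icc (1 : ℝ) 2 := by
    intro f i
    obtain ⟨hC, hs⟩ := child_items_bounds hb hpar i
    refine ⟨?_, ?_⟩
    · rw [le_div_iff₀ hC, one_mul, le_sub_iff_add_le, ← Finset.sum_add_distrib]
      refine le_of_le_of_eq ?_ (hb.2.1 i)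
      refine Finset.sum_le_sum fun j _ => ?_
      split_ifs
      · simp
      · have := childScale_le_one (par := par) h0 (fun i => (f i).2.1) j
        nlinarith [h0 i j]
    · rw [div_le_iff₀ hC]
      exact hs _ fun j hj =>
        child_loss_le h0 hb.2.2 (fun i => (f i).2.1) (fun i => (f i).2.2) hj
  let Φ : (A → Set.Icc (1 : ℝ) 2) →o (A → Set.Icc (1 : ℝ) 2) :=
    { toFun := fun f i => ⟨_, hval f i⟩
      monotone' := by
        intro f g hfg i
        have hC := (child_items_bounds hb hpar i).1
        refine Subtype.mk_le_mk.2 (div_le_div_of_nonneg_right (sub_le_sub_left ?_ _) hC.le)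
        refine Finset.sum_le_sum fun j _ => ?_
        split_ifs
        · exact le_rfl
        · exact mul_le_mul_of_nonneg_right
            (childScale_antitone h0 (fun i => hfg i) j) (h0 i j) }
  refine ⟨fun i => (OrderHom.lfp Φ i : ℝ), fun i => (OrderHom.lfp Φ i).2.1,
    fun i => (OrderHom.lfp Φ i).2.2, fun i => ?_⟩
  have hC := (child_items_bounds hb hpar i).1
  have hfix := congrArg Subtype.val (congrFun (OrderHom.map_lfp Φ) i)
  have := (div_eq_iff hC.ne').1 hfix
  linarith

end

/-- Lemma `pruned-sol`: Let `(b*, q*)` be an acyclic feasible point in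
`P(𝒜,𝒢)` and let `F` (given by the parent function `par`) be the rooted forest obtained by
rooting every connected component of `G_supp(b*)` at an agent node.  Then there exists a
feasible point `b^pruned` supported within the support of `b*` such that:
(1) `q^pruned_j ≥ q*_j` for every item `j` with `q*_j ≥ 1/2`;
(2) every item `j` with `q*_j < 1/2` is a leaf of `G_supp(b^pruned)` whose unique neighbor is
    its parent agent in `F`; and
(3) `b^pruned_{ij} ≤ min{1, 2 b*_{ij}}` for every `(i,j)`. -/
theorem pruned_solution_exists
    (A G : Type*) [Fintype A] [Fintype G]
    (bstar : A → G → ℝ)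
    (hbstar : Feasible bstar)
    (hacyc : (supportGraph bstar).IsAcyclic)
    (par : G → A) (hpar : IsParentFn bstar par) :
    ∃ bp : A → G → ℝ, Feasible bp ∧
      (∀ i j, bstar i j = 0 → bp i j = 0) ∧
      (∀ j, 1 / 2 ≤ ∑ i, bstar i j → (∑ i, bstar i j) ≤ ∑ i, bp i j) ∧
      (∀ j, (∑ i, bstar i j) < 1 / 2 →
        (0 < ∑ i, bstar i j → 0 < bp (par j) j) ∧ (∀ i, 0 < bp i j → i = par j)) ∧
      (∀ i j, bp i j ≤ min 1 (2 * bstar i j)) := by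
  classical
  obtain ⟨f, hf1, hf2, hf⟩ := exists_agent_scale hbstar hpar
  obtain ⟨h0, hrow, hcol⟩ := hbstar
  have ht0 := childScale_nonneg (par := par) h0 f
  have ht1 := childScale_le_one (par := par) h0 hf1
  set t := childScale bstar par f with ht
  let bp : A → G → ℝ := fun i j =>
    if par j = i then f (par j) * bstar i j else t j * bstar i j
  have hbp0 : ∀ i j, 0 ≤ bp i j := fun i j => by
    simp only [bp]
    split_ifs
    · exact mul_nonneg (by linarith [hf1 (par j)]) (h0 i j)
    · exact mul_nonneg (ht0 j) (h0 i j)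
  have hbprow : ∀ i, ∑ j, bp i j = 1 := fun i => by
    rw [← hf i, Finset.mul_sum, ← Finset.sum_add_distrib]
    refine Finset.sum_congr rfl fun j _ => ?_
    simp only [bp]
    split_ifs with h
    · rw [h, add_zero]
    · simp
  have hbp1 : ∀ i j, bp i j ≤ 1 := fun i j => by
    rw [← hbprow i]
    exact Finset.single_le_sum (fun j _ => hbp0 i j) (Finset.mem_univ j)
  have hbpcol : ∀ j, ∑ i, bp i j = f (par j) * bstar (par j) j +
      t j * (∑ i, bstar i j - bstar (par j) j) := fun j => sum_parent_child _ _ j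
  have hpj : ∀ j, f (par j) * bstar (par j) j ≤ 1 := fun j => by
    simpa [bp] using hbp1 (par j) j
  have hsmall : ∀ j, ∑ i, bstar i j < 1 / 2 → t j = 0 := fun j hj => if_pos hj
  refine ⟨bp, ⟨hbp0, hbprow, fun j => ?_⟩, fun i j h => ?_, fun j hj => ?_, fun j hj => ⟨?_, ?_⟩,
    fun i j => le_min (hbp1 i j) ?_⟩
  · rw [hbpcol]
    rcases lt_or_ge (∑ i, bstar i j) (1 / 2) with hj | hj
    · rw [hsmall j hj, zero_mul, add_zero]
      exact hpj j
    · rw [childScale_mul_of_half_le h0 hf1 hj, ← max_add_add_left]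
      exact max_le (by linarith [hpj j]) (by linarith [hcol j])
  · simp [bp, h]
  · rw [hbpcol, childScale_mul_of_half_le h0 hf1 hj]
    linarith [le_max_right 0 (∑ i, bstar i j - f (par j) * bstar (par j) j)]
  · intro hq
    simp only [bp, if_true]
    exact mul_pos (by linarith [hf1 (par j)]) (hpar.1 j hq)
  · intro i hi
    by_contra hne
    simp only [bp, if_neg (Ne.symm hne), hsmall j hj, zero_mul, lt_irrefl] at hi
  · simp only [bp]
    split_ifs
    · exact mul_le_mul_of_nonneg_right (hf2 _) (h0 i j)
    · exact mul_le_mul_of_nonneg_right (by linarith [ht1 j]) (h0 i j)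
end

section
/- Under the matching assumption, the optimal value of the unweighted log-concave relaxation equals the inf–max value of the priced program: sup_{x∈X} inf_{y∈Q} Σ_{i∈𝒜} log(Σ_{j∈𝒢} x_{ij} v_{ij} y_j) = inf_{δ∈ℝ^𝒢} sup_{x∈X} [ Σ_{i∈𝒜} log(Σ_{j∈𝒢} x_{ij} v_{ij} e^{−δ_j}) + Σ_{j∈𝒢} max(0, δ_j) ]. -/
open Finset

lemma elog_eq_log_ofReal (x : ℝ) : elog x = ENNReal.log (ENNReal.ofReal x) :=
  (ENNReal.log_ofReal x).symm

lemma sum_elog_eq_log_ofReal_prod {ι : Type*} (s : Finset ι) (a : ι → ℝ) (ha : ∀ i ∈ s, 0 ≤ a i) :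
    ∑ i ∈ s, elog (a i) = ENNReal.log (ENNReal.ofReal (∏ i ∈ s, a i)) := by
  classical
  induction s using Finset.induction_on with
  | empty => simp
  | insert i s hi ih =>
    rw [sum_insert hi, prod_insert hi, ih fun k hk => ha k (mem_insert_of_mem hk),
      ENNReal.ofReal_mul (ha i (mem_insert_self i s)), ENNReal.log_mul_add, elog_eq_log_ofReal]

lemma monotone_log_ofReal : Monotone fun r : ℝ => ENNReal.log (ENNReal.ofReal r) :=
  ENNReal.log_monotone.comp fun _ _ h => ENNReal.ofReal_le_ofReal h

lemma convexOn_sum {E ι : Type*} [AddCommGroup E] [Module ℝ E] {K : Set E} (s : Finset ι)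
    (hK : Convex ℝ K) {f : ι → E → ℝ} (hf : ∀ i ∈ s, ConvexOn ℝ K (f i)) :
    ConvexOn ℝ K fun x => ∑ i ∈ s, f i x := by
  refine ⟨hK, fun x hx y hy a b ha hb hab => ?_⟩
  simp only [smul_sum, ← sum_add_distrib]
  exact sum_le_sum fun i hi => (hf i hi).2 hx hy ha hb hab

lemma convexOn_exp_comp {E : Type*} [AddCommGroup E] [Module ℝ E] {K : Set E} {f : E → ℝ}
    (hf : ConvexOn ℝ K f) : ConvexOn ℝ K fun x => Real.exp (f x) :=
  ⟨hf.1, fun _ hx _ hy _ _ ha hb hab => (Real.exp_le_exp.2 (hf.2 hx hy ha hb hab)).trans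
    (convexOn_exp.2 (Set.mem_univ _) (Set.mem_univ _) ha hb hab)⟩

/-- Fractional allocations of the items in `G` to the agents in `A`. -/
def fractionalAllocations (A G : Type*) [Fintype A] : Set (A → G → ℝ) :=
  {x | (∀ i j, 0 ≤ x i j) ∧ ∀ j, ∑ i, x i j = 1}

lemma convex_fractionalAllocations (A G : Type*) [Fintype A] :
    Convex ℝ (fractionalAllocations A G) := by
  intro x hx y hy a b ha hb hab
  refine ⟨fun i j => ?_, fun j => ?_⟩
  · have := hx.1 i j
    have := hy.1 i j
    simp only [Pi.add_apply, Pi.smul_apply, smul_eq_mul]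
    positivity
  · simp only [Pi.add_apply, Pi.smul_apply, smul_eq_mul, sum_add_distrib, ← mul_sum]
    rw [hx.2 j, hy.2 j, mul_one, mul_one, hab]

lemma isCompact_fractionalAllocations (A G : Type*) [Fintype A] :
    IsCompact (fractionalAllocations A G) := by
  refine IsCompact.of_isClosed_subset
    (isCompact_univ_pi fun _ : A => isCompact_univ_pi fun _ : G => isCompact_Icc (a := (0 : ℝ))
      (b := 1)) ?_ ?_
  · have h₁ : IsClosed {x : A → G → ℝ | ∀ i j, 0 ≤ x i j} := by
      simp only [Set.ofPred_forall]
      exact isClosed_iInter fun i => isClosed_iInter fun j =>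
        isClosed_le continuous_const (by fun_prop)
    have h₂ : IsClosed {x : A → G → ℝ | ∀ j, ∑ i, x i j = 1} := by
      simp only [Set.ofPred_forall]
      exact isClosed_iInter fun j => isClosed_eq (by fun_prop) continuous_const
    exact h₁.inter h₂
  · intro x hx i _ j _
    refine ⟨hx.1 i j, ?_⟩
    rw [← hx.2 j]
    exact single_le_sum (f := fun i => x i j) (fun i _ => hx.1 i j) (mem_univ i)

section PricedProduct

variable {A G : Type*} [Fintype A] [Fintype G]

/-- The exponential of the objective of the priced program, where `c i j` is the utility that
agent `i` derives from its share of item `j`. -/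
noncomputable def pricedProduct (c : A → G → ℝ) (δ : G → ℝ) : ℝ :=
  (∏ i, ∑ j, c i j * Real.exp (-δ j)) * Real.exp (∑ j, max 0 (δ j))

lemma pricedProduct_eq_sum [DecidableEq A] (c : A → G → ℝ) (δ : G → ℝ) :
    pricedProduct c δ =
      ∑ φ : A → G, (∏ i, c i (φ i)) * Real.exp (∑ i, -δ (φ i) + ∑ j, max 0 (δ j)) := by
  rw [pricedProduct, prod_univ_sum, Fintype.piFinset_univ, sum_mul]
  refine sum_congr rfl fun φ _ => ?_
  rw [prod_mul_distrib, ← Real.exp_sum, mul_assoc, Real.exp_add]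

lemma convexOn_pricedProduct (c : A → G → ℝ) (hc : ∀ i j, 0 ≤ c i j) :
    ConvexOn ℝ Set.univ (pricedProduct c) := by
  classical
  have hmax (j : G) : ConvexOn ℝ Set.univ fun δ : G → ℝ => max 0 (δ j) :=
    (convexOn_const 0 convex_univ).sup
      ((LinearMap.proj j : (G → ℝ) →ₗ[ℝ] ℝ).convexOn convex_univ)
  have hneg (j : G) : ConvexOn ℝ Set.univ fun δ : G → ℝ => -δ j :=
    (-(LinearMap.proj j : (G → ℝ) →ₗ[ℝ] ℝ)).convexOn convex_univ
  have hexponent (φ : A → G) :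
      ConvexOn ℝ Set.univ fun δ : G → ℝ => ∑ i, -δ (φ i) + ∑ j, max 0 (δ j) :=
    (convexOn_sum _ convex_univ fun i _ => hneg (φ i)).add
      (convexOn_sum _ convex_univ fun j _ => hmax j)
  have hexp (φ : A → G) :
      ConvexOn ℝ Set.univ fun δ : G → ℝ => Real.exp (∑ i, -δ (φ i) + ∑ j, max 0 (δ j)) :=
    convexOn_exp_comp (hexponent φ)
  rw [funext (pricedProduct_eq_sum c)]
  exact convexOn_sum _ convex_univ fun φ _ =>
    (hexp φ).smul (prod_nonneg fun i _ => hc i (φ i))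

lemma min_prod_le_prod_add {ι : Type*} (s : Finset ι) (p q : ι → ℝ)
    (hp : ∀ i ∈ s, 0 ≤ p i) (hq : ∀ i ∈ s, 0 ≤ q i) {a b : ℝ} (ha : 0 ≤ a) (hb : 0 ≤ b)
    (hab : a + b = 1) :
    min (∏ i ∈ s, p i) (∏ i ∈ s, q i) ≤ ∏ i ∈ s, (a * p i + b * q i) := by
  set m := min (∏ i ∈ s, p i) (∏ i ∈ s, q i)
  have hm : 0 ≤ m := le_min (prod_nonneg hp) (prod_nonneg hq)
  calc
    m = m ^ a * m ^ b := by rw [← Real.rpow_add_of_nonneg hm ha hb, hab, Real.rpow_one]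
    _ ≤ (∏ i ∈ s, p i) ^ a * (∏ i ∈ s, q i) ^ b :=
      mul_le_mul (Real.rpow_le_rpow hm (min_le_left _ _) ha)
        (Real.rpow_le_rpow hm (min_le_right _ _) hb) (Real.rpow_nonneg hm _)
        (Real.rpow_nonneg (prod_nonneg hp) _)
    _ = ∏ i ∈ s, p i ^ a * q i ^ b := by
      rw [prod_mul_distrib, Real.finsetProd_rpow s p hp, Real.finsetProd_rpow s q hq]
    _ ≤ ∏ i ∈ s, (a * p i + b * q i) :=
      prod_le_prod
        (fun i hi => mul_nonneg (Real.rpow_nonneg (hp i hi) _) (Real.rpow_nonneg (hq i hi) _))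
        fun i hi => Real.geom_mean_le_arith_mean2_weighted ha hb (hp i hi) (hq i hi) hab

lemma quasiconcaveOn_pricedProduct (v : A → G → ℝ) (hv : ∀ i j, 0 ≤ v i j) (δ : G → ℝ) :
    QuasiconcaveOn ℝ (fractionalAllocations A G)
      fun x => pricedProduct (fun i j => x i j * v i j) δ := by
  rw [quasiconcaveOn_iff_min_le]
  refine ⟨convex_fractionalAllocations A G, fun x hx y hy a b ha hb hab => ?_⟩
  have hnonneg {z : A → G → ℝ} (hz : z ∈ fractionalAllocations A G) (i : A) :
      0 ≤ ∑ j, z i j * v i j * Real.exp (-δ j) :=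
    sum_nonneg fun j _ => mul_nonneg (mul_nonneg (hz.1 i j) (hv i j)) (Real.exp_nonneg _)
  simp only [pricedProduct]
  rw [← min_mul_of_nonneg _ _ (Real.exp_nonneg _)]
  refine mul_le_mul_of_nonneg_right ?_ (Real.exp_nonneg _)
  refine (min_prod_le_prod_add univ _ _ (fun i _ => hnonneg hx i) (fun i _ => hnonneg hy i)
    ha hb hab).trans_eq (prod_congr rfl fun i _ => ?_)
  rw [mul_sum, mul_sum, ← sum_add_distrib]
  refine sum_congr rfl fun j _ => ?_
  simp only [Pi.add_apply, Pi.smul_apply, smul_eq_mul]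
  ring

lemma sum_elog_add_eq_log_pricedProduct (c : A → G → ℝ) (hc : ∀ i j, 0 ≤ c i j) (δ : G → ℝ) :
    (∑ i, elog (∑ j, c i j * Real.exp (-δ j))) + ((∑ j, max 0 (δ j) : ℝ) : EReal) =
      ENNReal.log (ENNReal.ofReal (pricedProduct c δ)) := by
  have hnonneg (i : A) : 0 ≤ ∑ j, c i j * Real.exp (-δ j) :=
    sum_nonneg fun j _ => mul_nonneg (hc i j) (Real.exp_nonneg _)
  rw [sum_elog_eq_log_ofReal_prod _ _ fun i _ => hnonneg i, pricedProduct,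
    ENNReal.ofReal_mul (prod_nonneg fun i _ => hnonneg i), ENNReal.log_mul_add,
    ENNReal.log_ofReal_of_pos (Real.exp_pos _), Real.log_exp]

lemma iSup_iInf_log_pricedProduct (v : A → G → ℝ) (hv : ∀ i j, 0 ≤ v i j)
    (hne : (fractionalAllocations A G).Nonempty) :
    (⨆ x ∈ fractionalAllocations A G, ⨅ δ : G → ℝ,
        ENNReal.log (ENNReal.ofReal (pricedProduct (fun i j => x i j * v i j) δ))) =
      ⨅ δ : G → ℝ, ⨆ x ∈ fractionalAllocations A G,
        ENNReal.log (ENNReal.ofReal (pricedProduct (fun i j => x i j * v i j) δ)) := by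
  have hcont : Continuous fun p : (A → G → ℝ) × (G → ℝ) =>
      OrderDual.toDual
        (ENNReal.log (ENNReal.ofReal (pricedProduct (fun i j => p.1 i j * v i j) p.2))) := by
    refine continuous_toDual.comp
      (ENNReal.continuous_log.comp (ENNReal.continuous_ofReal.comp ?_))
    unfold pricedProduct
    fun_prop
  have h := Sion.minimax' (β := ERealᵒᵈ) (X := fractionalAllocations A G)
    (Y := (Set.univ : Set (G → ℝ)))
    (f := fun x δ => OrderDual.toDual
      (ENNReal.log (ENNReal.ofReal (pricedProduct (fun i j => x i j * v i j) δ))))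
    hne (convex_fractionalAllocations A G) (isCompact_fractionalAllocations A G)
    (fun δ _ => (hcont.comp (by fun_prop : Continuous fun x : A → G → ℝ =>
      (x, δ))).lowerSemicontinuous.lowerSemicontinuousOn _)
    (fun δ _ => ((quasiconcaveOn_pricedProduct v hv δ).monotone_comp monotone_log_ofReal).dual)
    convex_univ
    (fun x _ => (hcont.comp (by fun_prop : Continuous fun δ : G → ℝ =>
      (x, δ))).upperSemicontinuous.upperSemicontinuousOn _)
    (fun x hx => ((convexOn_pricedProduct _
      fun i j => mul_nonneg (hx.1 i j) (hv i j)).quasiconvexOn.monotone_comp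
        monotone_log_ofReal).dual)
  simp only [Set.mem_univ, iSup_pos] at h
  exact h

/-- Positive weights on the items whose product over any `n` items is at
least one. -/
def superunitWeights (G : Type*) (n : ℕ) : Set (G → ℝ) :=
  {y | (∀ j, 0 < y j) ∧ ∀ S : Finset G, S.card = n → 1 ≤ ∏ j ∈ S, y j}

lemma exists_card_eq_forall_le (z : G → ℝ) {n : ℕ} (hn : n ≤ Fintype.card G) :
    ∃ S : Finset G, S.card = n ∧ ∀ j ∈ S, ∀ k ∉ S, z j ≤ z k := by
  classical
  obtain ⟨S, hS, hmin⟩ := exists_min_image (powersetCard n (univ : Finset G))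
    (fun S => ∑ j ∈ S, z j) (powersetCard_nonempty.2 hn)
  have hcard := (mem_powersetCard.1 hS).2
  refine ⟨S, hcard, fun j hj k hk => ?_⟩
  have hk' : k ∉ S.erase j := fun h => hk (mem_of_mem_erase h)
  have h := hmin (insert k (S.erase j)) <| mem_powersetCard.2 ⟨subset_univ _, by
    rw [card_insert_of_notMem hk', card_erase_add_one hj, hcard]⟩
  rw [sum_insert hk', ← add_sum_erase S z hj] at h
  linarith

lemma exists_sum_max_le (z : G → ℝ) {n : ℕ} (hn₀ : 0 < n) (hn : n ≤ Fintype.card G)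
    (hz : ∀ S : Finset G, S.card = n → 0 ≤ ∑ j ∈ S, z j) :
    ∃ θ : ℝ, ∑ j, max 0 (θ - z j) ≤ n * θ := by
  obtain ⟨S, hS, hle⟩ := exists_card_eq_forall_le z hn
  obtain ⟨m, hm, hmax⟩ := exists_max_image S z (card_pos.1 (hS ▸ hn₀))
  refine ⟨z m, ?_⟩
  rw [← sum_subset (subset_univ S) fun k _ hk => max_eq_left (sub_nonpos.2 (hle m hm k hk)),
    sum_congr rfl fun j hj => max_eq_right (sub_nonneg.2 (hmax j hj)), sum_sub_distrib,
    sum_const, hS, nsmul_eq_mul]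
  linarith [hz S hS]

lemma prod_sum_mul_exp_sub (c : A → G → ℝ) (δ : G → ℝ) (θ : ℝ) :
    ∏ i, ∑ j, c i j * Real.exp (θ - δ j) =
      (∏ i, ∑ j, c i j * Real.exp (-δ j)) * Real.exp (Fintype.card A * θ) := by
  rw [Real.exp_nat_mul, ← card_univ, ← prod_const, ← prod_mul_distrib]
  refine prod_congr rfl fun i _ => ?_
  rw [sum_mul]
  refine sum_congr rfl fun j _ => ?_
  rw [mul_assoc, ← Real.exp_add, neg_add_eq_sub]

lemma iInf_superunitWeights_eq_iInf_log_pricedProduct [Nonempty A]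
    (hcard : Fintype.card A ≤ Fintype.card G) (c : A → G → ℝ) (hc : ∀ i j, 0 ≤ c i j) :
    (⨅ y ∈ superunitWeights G (Fintype.card A), ∑ i, elog (∑ j, c i j * y j)) =
      ⨅ δ : G → ℝ, ENNReal.log (ENNReal.ofReal (pricedProduct c δ)) := by
  have hpos : 0 < Fintype.card A := Fintype.card_pos
  have hsum {y : G → ℝ} (hy : ∀ j, 0 < y j) (i : A) : 0 ≤ ∑ j, c i j * y j :=
    sum_nonneg fun j _ => mul_nonneg (hc i j) (hy j).le
  apply le_antisymm
  · refine le_iInf fun δ => ?_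
    obtain ⟨θ, hθ⟩ : ∃ θ : ℝ, (Fintype.card A : ℝ) * θ = ∑ j, max 0 (δ j) :=
      ⟨(∑ j, max 0 (δ j)) / Fintype.card A, by field_simp⟩
    refine iInf₂_le_of_le (fun j => Real.exp (θ - δ j))
      ⟨fun j => Real.exp_pos _, fun S hS => ?_⟩ ?_
    · rw [← Real.exp_sum, Real.one_le_exp_iff, sum_sub_distrib, sum_const, hS, nsmul_eq_mul, hθ,
        sub_nonneg]
      exact (sum_le_sum fun j _ => le_max_right 0 (δ j)).trans
        (sum_le_univ_sum_of_nonneg fun j => le_max_left 0 (δ j))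
    · rw [sum_elog_eq_log_ofReal_prod _ _ fun i _ => hsum (fun j => Real.exp_pos _) i,
        prod_sum_mul_exp_sub, hθ, pricedProduct]
  · refine le_iInf₂ fun y hy => ?_
    obtain ⟨θ, hθ⟩ := exists_sum_max_le (fun j => Real.log (y j)) hpos hcard fun S hS => by
      rw [← Real.log_prod fun j _ => (hy.1 j).ne']
      exact Real.log_nonneg (hy.2 S hS)
    refine iInf_le_of_le (fun j => θ - Real.log (y j)) ?_
    rw [sum_elog_eq_log_ofReal_prod _ _ fun i _ => hsum hy.1 i]
    refine monotone_log_ofReal ?_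
    have h := prod_sum_mul_exp_sub c (fun j => θ - Real.log (y j)) θ
    simp only [sub_sub_cancel, Real.exp_log (hy.1 _)] at h
    rw [h, pricedProduct]
    exact mul_le_mul_of_nonneg_left (Real.exp_le_exp.2 hθ)
      (prod_nonneg fun i _ => hsum (fun j => Real.exp_pos _) i)

end PricedProduct

/-- Lemma `sym-eq-1`: Under the matching assumption,
`sup_{x∈X} inf_{y∈Q} Σ_i log(Σ_j x_{ij} v_{ij} y_j)
  = inf_{δ∈ℝ^𝒢} sup_{x∈X} [ Σ_i log(Σ_j x_{ij} v_{ij} e^{−δ_j}) + Σ_j max(0, δ_j) ]`,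
with `log 0 = −∞` and sup/inf taken in the extended reals. -/
theorem logconcave_eq_priced_program
    (A G : Type*) [Fintype A] [Fintype G]
    (v : A → G → ℝ) (hv : ∀ i j, 0 ≤ v i j)
    (hmatch : ∃ f : A → G, Function.Injective f ∧ ∀ i, 0 < v i (f i)) :
    (⨆ x ∈ {x : A → G → ℝ | (∀ i j, 0 ≤ x i j) ∧ ∀ j, ∑ i, x i j = 1},
      ⨅ y ∈ {y : G → ℝ | (∀ j, 0 < y j) ∧
          ∀ S : Finset G, S.card = Fintype.card A → 1 ≤ ∏ j ∈ S, y j},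
        ∑ i, elog (∑ j, x i j * v i j * y j))
    = ⨅ δ : G → ℝ,
        ⨆ x ∈ {x : A → G → ℝ | (∀ i j, 0 ≤ x i j) ∧ ∀ j, ∑ i, x i j = 1},
          ((∑ i, elog (∑ j, x i j * v i j * Real.exp (-δ j)))
            + ((∑ j, max 0 (δ j) : ℝ) : EReal)) := by
  change (⨆ x ∈ fractionalAllocations A G, ⨅ y ∈ superunitWeights G (Fintype.card A), _) =
    ⨅ δ : G → ℝ, ⨆ x ∈ fractionalAllocations A G, _
  obtain hX | hne := (fractionalAllocations A G).eq_empty_or_nonempty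
  · simp [hX]
  obtain _ | _ := isEmpty_or_nonempty A
  · have : IsEmpty G := ⟨fun j => by simpa using hne.choose_spec.2 j⟩
    simp [fractionalAllocations, superunitWeights]
  · obtain ⟨f, hf, -⟩ := hmatch
    have hc {x : A → G → ℝ} (hx : x ∈ fractionalAllocations A G) (i : A) (j : G) :
        0 ≤ x i j * v i j := mul_nonneg (hx.1 i j) (hv i j)
    rw [biSup_congr fun x hx => iInf_superunitWeights_eq_iInf_log_pricedProduct
        (Fintype.card_le_of_injective f hf) _ (hc hx),
      iSup_iInf_log_pricedProduct v hv hne]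
    exact iInf_congr fun δ => biSup_congr fun x hx =>
      (sum_elog_add_eq_log_pricedProduct _ (hc hx) δ).symm
end

section
/- Let x ∈ X with x_{ij} ∈ {0,1} for all (i,j) be an integral allocation such that Σ_{j∈𝒢} x_{ij} v_{ij} > 0 for every agent i. Then inf_{y∈Q} Σ_{i∈𝒜} w_i · log(Σ_{j∈𝒢} x_{ij} v_{ij} y_j^{1/w_i}) = Σ_{i∈𝒜} w_i · log(Σ_{j∈𝒢} x_{ij} v_{ij}); in particular the infimum is attained at y = (1, …, 1). -/
open Finset

/-- Lemma `LogConcave-ASym-isrelax`: For an integral allocation `x ∈ X`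
(each `x_{ij} ∈ {0,1}`) with `Σ_j x_{ij} v_{ij} > 0` for every agent `i`,
`inf_{y∈Q} Σ_i w_i log(Σ_j x_{ij} v_{ij} y_j^{1/w_i}) = Σ_i w_i log(Σ_j x_{ij} v_{ij})`,
and the infimum is attained at `y = (1,…,1)` (formalized as: the right-hand side is the
least element of the set of values of the inner objective over `y ∈ Q`). -/
theorem integral_allocation_inner_inf
    (A G : Type*) [Fintype A] [Fintype G]
    (v : A → G → ℝ) (w : A → ℝ)
    (hv : ∀ i j, 0 ≤ v i j) (hw : ∀ i, 0 < w i) (hws : ∑ i, w i = 1)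
    (x : A → G → ℝ)
    (hx01 : ∀ i j, x i j = 0 ∨ x i j = 1)
    (hxsum : ∀ j, ∑ i, x i j = 1)
    (hpos : ∀ i, 0 < ∑ j, x i j * v i j) :
    IsLeast
      {z : ℝ | ∃ y : G → ℝ,
        ((∀ j, 0 < y j) ∧
          ∀ S : Finset G, S.card = Fintype.card A → 1 ≤ ∏ j ∈ S, y j) ∧
        z = ∑ i, w i * Real.log (∑ j, x i j * v i j * y j ^ (1 / w i))}
      (∑ i, w i * Real.log (∑ j, x i j * v i j)) := by
  classical
  refine ⟨⟨fun _ => 1, ⟨fun _ => one_pos, fun S _ => by simp⟩, by simp⟩, ?_⟩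
  rintro z ⟨y, ⟨hy, hQ⟩, rfl⟩
  have hx0 : ∀ i j, 0 ≤ x i j := fun i j => by
    rcases hx01 i j with h | h <;> simp [h]
  have hnn : ∀ i j, 0 ≤ x i j * v i j := fun i j => mul_nonneg (hx0 i j) (hv i j)
  -- each agent picks the item of smallest price among those it receives and values
  have hmin : ∀ i, ∃ j, x i j = 1 ∧ ∀ k, 0 < x i k * v i k → y j ≤ y k := by
    intro i
    obtain ⟨j₀, -, hj₀⟩ := exists_lt_of_sum_lt (s := univ) (f := fun _ : G => (0 : ℝ))
      (g := fun j => x i j * v i j) (by simpa using hpos i)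
    obtain ⟨j, hj, hle⟩ := (univ.filter fun j => 0 < x i j * v i j).exists_min_image y
      ⟨j₀, by simpa using hj₀⟩
    refine ⟨j, (hx01 i j).resolve_left fun h => ?_, fun k hk => hle k (by simpa using hk)⟩
    simp [h] at hj
  choose f hf1 hfmin using hmin
  have hinj : Function.Injective f := by
    intro a b hab
    by_contra hne
    have hle := sum_le_sum_of_subset_of_nonneg (subset_univ {a, b})
      (fun i _ _ => hx0 i (f a))
    rw [sum_pair hne, hxsum, hf1 a, hab, hf1 b] at hle
    norm_num at hle
  have hprod : 0 ≤ ∑ i, Real.log (y (f i)) := by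
    rw [← Real.log_prod fun i _ => (hy (f i)).ne']
    refine Real.log_nonneg ?_
    have h := hQ (univ.image f) (by rw [card_image_of_injective _ hinj, card_univ])
    rwa [prod_image hinj.injOn] at h
  have hagent : ∀ i, w i * Real.log (∑ j, x i j * v i j) + Real.log (y (f i)) ≤
      w i * Real.log (∑ j, x i j * v i j * y j ^ (1 / w i)) := by
    intro i
    have hpow : 0 < y (f i) ^ (1 / w i) := Real.rpow_pos_of_pos (hy _) _
    have hsum : (∑ j, x i j * v i j) * y (f i) ^ (1 / w i) ≤
        ∑ j, x i j * v i j * y j ^ (1 / w i) := by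
      rw [sum_mul]
      refine sum_le_sum fun j _ => ?_
      rcases (hnn i j).eq_or_lt with h | h
      · simp [← h]
      · exact mul_le_mul_of_nonneg_left
          (Real.rpow_le_rpow (hy _).le (hfmin i j h) (one_div_pos.2 (hw i)).le) h.le
    have hlog := Real.log_le_log (mul_pos (hpos i) hpow) hsum
    rw [Real.log_mul (hpos i).ne' hpow.ne', Real.log_rpow (hy _)] at hlog
    calc w i * Real.log (∑ j, x i j * v i j) + Real.log (y (f i))
        = w i * (Real.log (∑ j, x i j * v i j) + 1 / w i * Real.log (y (f i))) := by
          have := (hw i).ne'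
          field_simp
      _ ≤ _ := mul_le_mul_of_nonneg_left hlog (hw i).le
  have htotal := sum_le_sum fun i (_ : i ∈ univ) => hagent i
  rw [sum_add_distrib] at htotal
  linarith
end
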